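/- There exists a map σ_n² from the bounded measurable functions on X to [0, ∞) such that for every bounded measurable φ on X: (1) E[γ_n^N(φ)] = γ_n(φ) for all N ≥ 1; (2) γ_n^N(φ) → γ_n(φ) almost surely and N·var(γ_n^N(φ)/γ_n(1)) → σ_n²(φ) as N → ∞; (3) η_n^N(φ) → η_n(φ) almost surely and N·E[(η_n^N(φ) − η_n(φ))²] → σ_n²(φ − η_n(φ)) as N → ∞. -/

import Mathlib

open MeasureTheory ProbabilityTheory Filter
open scoped ENNReal NNReal Classical

noncomputable section

namespace PFVar

variable {X : Type*} [MeasurableSpace X]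

/-- The unnormalized Feynman–Kac measures `γ_p`. -/
def gammaFK (M0 : Measure X) (M : ℕ → Kernel X X) (G : ℕ → X → ℝ) : ℕ → Measure X
  | 0 => M0
  | p + 1 =>
      ((gammaFK M0 M G p).withDensity fun x => ENNReal.ofReal (G p x)).bind
        (fun x => M (p + 1) x)

/-- `γ_n(φ)`. -/
def gInt (M0 : Measure X) (M : ℕ → Kernel X X) (G : ℕ → X → ℝ) (n : ℕ) (φ : X → ℝ) : ℝ :=
  ∫ x, φ x ∂(gammaFK M0 M G n)

/-- `η_n(φ) = γ_n(φ)/γ_n(1)`. -/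
def eInt (M0 : Measure X) (M : ℕ → Kernel X X) (G : ℕ → X → ℝ) (n : ℕ) (φ : X → ℝ) : ℝ :=
  gInt M0 M G n φ / gInt M0 M G n 1

/-- Law of the path `(X_0,…,X_k)` of an inhomogeneous Markov chain with initial law `μ0` and
transitions `κ`, recorded as an element of `ℕ → Y` (coordinates beyond `k` are junk). -/
def markovPath {Y : Type*} [MeasurableSpace Y] (μ0 : Measure Y) (κ : ℕ → Y → Measure Y) :
    ℕ → Measure (ℕ → Y)
  | 0 => μ0.map fun y _ => y
  | k + 1 =>
      (markovPath μ0 κ k).bind fun ω =>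
        (κ (k + 1) (ω k)).map fun y => Function.update ω (k + 1) y

/-- Categorical distribution on `{0,…,m−1} ⊆ ℕ` with weights `w`. -/
def cat (m : ℕ) (w : ℕ → ℝ) : Measure ℕ :=
  (∑ j ∈ Finset.range m, ENNReal.ofReal (w j))⁻¹ •
    ∑ j ∈ Finset.range m, ENNReal.ofReal (w j) • Measure.dirac j

/-- Uniform distribution on `{0,…,m−1}`. -/
def unif (m : ℕ) : Measure ℕ := cat m fun _ => 1

/-- Extend a finite tuple to `ℕ` with junk values. -/
def padF {Y : Type*} [Nonempty Y] {m : ℕ} (f : Fin m → Y) : ℕ → Y := fun i =>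
  if h : i < m then f ⟨i, h⟩ else Classical.arbitrary Y

/-- One resampling/mutation step of the particle filter: given the time-`p` configuration `z`,
the joint law of the ancestor indices `A_p` and the time-`p+1` particle configuration;
each of the `Np (p+1)` new particles independently draws an ancestor from the categorical
distribution with weights `G p (z j)`, `j < Np p`, and then moves according to `M (p+1)`. -/
def pfStep [Nonempty X] (M : ℕ → Kernel X X) (G : ℕ → X → ℝ) (Np : ℕ → ℕ) (p : ℕ)
    (z : ℕ → X) : Measure ((ℕ → ℕ) × (ℕ → X)) :=
  (Measure.pi fun _ : Fin (Np (p + 1)) =>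
      (cat (Np p) fun j => G p (z j)).bind fun a =>
        (M (p + 1) (z a)).map fun x => (a, x)).map fun f =>
    (padF fun i => (f i).1, padF fun i => (f i).2)

/-- The law of the particle system `(ζ, A)` run up to time `k`: the first component is
`ζ : time → particle index → X`, the second is `A : time → particle index → ℕ`, where
`A p i` is the ancestor index of particle `i` of generation `p+1`. -/
def pfLaw [Nonempty X] (M0 : Measure X) (M : ℕ → Kernel X X) (G : ℕ → X → ℝ)
    (Np : ℕ → ℕ) : ℕ → Measure ((ℕ → ℕ → X) × (ℕ → ℕ → ℕ))
  | 0 =>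
      (Measure.pi fun _ : Fin (Np 0) => M0).map fun f =>
        (fun p => if p = 0 then padF f else fun _ => Classical.arbitrary X, fun _ _ => 0)
  | k + 1 =>
      (pfLaw M0 M G Np k).bind fun ω =>
        (pfStep M G Np k (ω.1 k)).map fun az =>
          (Function.update ω.1 (k + 1) az.2, Function.update ω.2 k az.1)

/-- Eve indices: `eve A 0 i = i` and `eve A (p+1) i = eve A p (A p i)`. -/
def eve (A : ℕ → ℕ → ℕ) : ℕ → ℕ → ℕ
  | 0 => fun i => i
  | p + 1 => fun i => eve A p (A p i)

/-- `η_n^N(φ)`. -/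
def etaN (Np : ℕ → ℕ) (n : ℕ) (φ : X → ℝ) (ω : (ℕ → ℕ → X) × (ℕ → ℕ → ℕ)) : ℝ :=
  (Np n : ℝ)⁻¹ * ∑ i ∈ Finset.range (Np n), φ (ω.1 n i)

/-- `γ_n^N(φ)`. -/
def gammaN (G : ℕ → X → ℝ) (Np : ℕ → ℕ) (n : ℕ) (φ : X → ℝ)
    (ω : (ℕ → ℕ → X) × (ℕ → ℕ → ℕ)) : ℝ :=
  (∏ p ∈ Finset.range n, etaN Np p (G p) ω) * etaN Np n φ ω

/-- The variance estimator `V_n^N(φ)`. -/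
def Vest (Np : ℕ → ℕ) (n : ℕ) (φ : X → ℝ) (ω : (ℕ → ℕ → X) × (ℕ → ℕ → ℕ)) : ℝ :=
  etaN Np n φ ω ^ 2 -
    (∏ p ∈ Finset.range n, (Np p : ℝ) / ((Np p : ℝ) - 1)) *
      ((Np n : ℝ) * ((Np n : ℝ) - 1))⁻¹ *
      ∑ i ∈ Finset.range (Np n), ∑ j ∈ Finset.range (Np n),
        if eve ω.2 n i ≠ eve ω.2 n j then φ (ω.1 n i) * φ (ω.1 n j) else 0

/-- Initial law of the doubled chain used to define `μ_b`. -/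
def pairInit (M0 : Measure X) (b : ℕ → Bool) : Measure (X × X) :=
  if b 0 then M0.map fun x => (x, x) else M0.prod M0

/-- Transitions of the doubled chain used to define `μ_b`. -/
def pairKer (M : ℕ → Kernel X X) (b : ℕ → Bool) (p : ℕ) (q : X × X) : Measure (X × X) :=
  if b p then (M p q.1).map fun y => (y, y) else (M p q.1).prod (M p q.2)

/-- `μ_b(φ) = E_b[φ(X_n, X_n') ∏_{p<n} G_p(X_p) G_p(X_p')]`. -/
def muB (M0 : Measure X) (M : ℕ → Kernel X X) (G : ℕ → X → ℝ) (n : ℕ) (b : ℕ → Bool)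
    (φ : X × X → ℝ) : ℝ :=
  ∫ ω, φ (ω n) * ∏ p ∈ Finset.range n, G p (ω p).1 * G p (ω p).2
    ∂(markovPath (pairInit M0 b) (pairKer M b) n)

/-- `φ ⊗ φ`. -/
def tens (φ : X → ℝ) : X × X → ℝ := fun q => φ q.1 * φ q.2

/-- The binary string `e_p`. -/
def eVec (p : ℕ) : ℕ → Bool := fun q => q == p

/-- The zero binary string `0_n`. -/
def zeroVec : ℕ → Bool := fun _ => false

/-- Extension of a finite binary string to `ℕ → Bool`. -/
def extB (n : ℕ) (b : Fin (n + 1) → Bool) : ℕ → Bool := fun p =>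
  if h : p < n + 1 then b ⟨p, h⟩ else false

/-- `v_{p,n}(φ) = (μ_{e_p}(φ⊗φ) − μ_{0_n}(φ⊗φ)) / γ_n(1)²`. -/
def vpn (M0 : Measure X) (M : ℕ → Kernel X X) (G : ℕ → X → ℝ) (n p : ℕ) (φ : X → ℝ) : ℝ :=
  (muB M0 M G n (eVec p) (tens φ) - muB M0 M G n zeroVec (tens φ)) / gInt M0 M G n 1 ^ 2

/-- `σ_n²(φ) = Σ_{p=0}^n c_p⁻¹ v_{p,n}(φ)`. -/
def sigma2 (M0 : Measure X) (M : ℕ → Kernel X X) (G : ℕ → X → ℝ) (c : ℕ → ℝ) (n : ℕ)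
    (φ : X → ℝ) : ℝ :=
  ∑ p ∈ Finset.range (n + 1), (c p)⁻¹ * vpn M0 M G n p φ

/-- Particle numbers `N_p = ⌈c_p N⌉`. -/
def npart (c : ℕ → ℝ) (N : ℕ) (p : ℕ) : ℕ := ⌈c p * (N : ℝ)⌉₊

/-- Backward tracing: `traceAux A n kn j = K_{n-j}` where `K_n = kn`, `K_p = A p (K_{p+1})`. -/
def traceAux (A : ℕ → ℕ → ℕ) (n kn : ℕ) : ℕ → ℕ
  | 0 => kn
  | j + 1 => A (n - (j + 1)) (traceAux A n kn j)

/-- The deterministic ancestral trace `K¹`: `trace A n kn p = K_p¹` given `K_n¹ = kn`. -/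
def trace (A : ℕ → ℕ → ℕ) (n kn : ℕ) : ℕ → ℕ := fun p => traceAux A n kn (n - p)

/-- Conditional law of the broken-lineage trace `(K_0²,…,K_p²)` given `K_p² = v`
(entries above `p` are junk, to be overwritten). -/
def k2Law (G : ℕ → X → ℝ) (Np : ℕ → ℕ) (ω : (ℕ → ℕ → X) × (ℕ → ℕ → ℕ)) (K1 : ℕ → ℕ) :
    ℕ → ℕ → Measure (ℕ → ℕ)
  | 0 => fun v => Measure.dirac fun q => if q = 0 then v else 0
  | p + 1 => fun v =>
      ((if v = K1 (p + 1) then cat (Np p) fun j => G p (ω.1 p j)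
          else Measure.dirac (ω.2 p v)).bind fun w =>
        (k2Law G Np ω K1 p w).map fun f => Function.update f (p + 1) v)

/-- Conditional law of `(K¹, K²)` given the particle system `ω = (ζ, A)`. -/
def kLaw (G : ℕ → X → ℝ) (Np : ℕ → ℕ) (n : ℕ) (ω : (ℕ → ℕ → X) × (ℕ → ℕ → ℕ)) :
    Measure ((ℕ → ℕ) × (ℕ → ℕ)) :=
  (unif (Np n)).bind fun k1n =>
    (unif (Np n)).bind fun k2n =>
      (k2Law G Np ω (trace ω.2 n k1n) n k2n).map fun k2 => (trace ω.2 n k1n, k2)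

/-- Joint law of the particle system together with the tracing variables `(K¹, K²)`. -/
def pfkLaw [Nonempty X] (M0 : Measure X) (M : ℕ → Kernel X X) (G : ℕ → X → ℝ)
    (Np : ℕ → ℕ) (n : ℕ) :
    Measure (((ℕ → ℕ → X) × (ℕ → ℕ → ℕ)) × ((ℕ → ℕ) × (ℕ → ℕ))) :=
  (pfLaw M0 M G Np n).bind fun ω => (kLaw G Np n ω).map fun k => (ω, k)

/-- `(k¹, k²) ∈ I(b)`. -/
def inI (Np : ℕ → ℕ) (n : ℕ) (b : ℕ → Bool) (k : (ℕ → ℕ) × (ℕ → ℕ)) : Prop :=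
  ∀ p ≤ n, k.1 p < Np p ∧ k.2 p < Np p ∧ (k.1 p = k.2 p ↔ b p = true)

/-- The particle approximation `μ_b^N(φ)` (a function of the realization `ω = (ζ, A)`);
the conditional expectation given `(A, ζ)` is the integral with respect to `kLaw`. -/
def muBN (G : ℕ → X → ℝ) (Np : ℕ → ℕ) (n : ℕ) (b : ℕ → Bool) (φ : X × X → ℝ)
    (ω : (ℕ → ℕ → X) × (ℕ → ℕ → ℕ)) : ℝ :=
  (∏ p ∈ Finset.range (n + 1),
      if b p then (Np p : ℝ) else (Np p : ℝ) / ((Np p : ℝ) - 1)) *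
    gammaN G Np n 1 ω ^ 2 *
    ∫ k, (if inI Np n b k then (1 : ℝ) else 0) * φ (ω.1 n (k.1 n), ω.1 n (k.2 n))
      ∂(kLaw G Np n ω)

/-- `v_{p,n}^N(φ)`. -/
def vpnN (G : ℕ → X → ℝ) (Np : ℕ → ℕ) (n p : ℕ) (φ : X → ℝ)
    (ω : (ℕ → ℕ → X) × (ℕ → ℕ → ℕ)) : ℝ :=
  (muBN G Np n (eVec p) (tens φ) ω - muBN G Np n zeroVec (tens φ) ω) / gammaN G Np n 1 ω ^ 2

/-- `v_n^N(φ) = Σ_{p=0}^n c_p⁻¹ v_{p,n}^N(φ)`. -/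
def vnN (G : ℕ → X → ℝ) (Np : ℕ → ℕ) (c : ℕ → ℝ) (n : ℕ) (φ : X → ℝ)
    (ω : (ℕ → ℕ → X) × (ℕ → ℕ → ℕ)) : ℝ :=
  ∑ p ∈ Finset.range (n + 1), (c p)⁻¹ * vpnN G Np n p φ ω

/-- `QAux M G n φ j = Q_{n-j,n}(φ)`. -/
def QAux (M : ℕ → Kernel X X) (G : ℕ → X → ℝ) (n : ℕ) (φ : X → ℝ) : ℕ → X → ℝ
  | 0 => φ
  | j + 1 => fun x => G (n - (j + 1)) x * ∫ y, QAux M G n φ j y ∂(M (n - j) x)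

/-- `Q_{p,n}(φ)` where `Q_p(x, dx') = G_{p-1}(x) M_p(x, dx')`, `Q_{n,n} = Id`,
`Q_{p,n} = Q_{p+1} ⋯ Q_n`. -/
def Qpn (M : ℕ → Kernel X X) (G : ℕ → X → ℝ) (n p : ℕ) (φ : X → ℝ) : X → ℝ :=
  QAux M G n φ (n - p)

/-- `φ̂ = G_n · φ`. -/
def hatf (G : ℕ → X → ℝ) (n : ℕ) (φ : X → ℝ) : X → ℝ := fun x => G n x * φ x

/-- `γ̂_n(φ) = γ_n(G_n φ)`. -/
def gHatInt (M0 : Measure X) (M : ℕ → Kernel X X) (G : ℕ → X → ℝ) (n : ℕ) (φ : X → ℝ) : ℝ :=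
  gInt M0 M G n (hatf G n φ)

/-- `η̂_n(φ) = γ̂_n(φ)/γ̂_n(1)`. -/
def eHatInt (M0 : Measure X) (M : ℕ → Kernel X X) (G : ℕ → X → ℝ) (n : ℕ) (φ : X → ℝ) : ℝ :=
  gHatInt M0 M G n φ / gHatInt M0 M G n 1

/-- `γ̂_n^N(φ) = γ_n^N(G_n φ)`. -/
def gammaHatN (G : ℕ → X → ℝ) (Np : ℕ → ℕ) (n : ℕ) (φ : X → ℝ)
    (ω : (ℕ → ℕ → X) × (ℕ → ℕ → ℕ)) : ℝ :=
  gammaN G Np n (hatf G n φ) ω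

/-- `η̂_n^N(φ) = γ̂_n^N(φ)/γ̂_n^N(1)`. -/
def etaHatN (G : ℕ → X → ℝ) (Np : ℕ → ℕ) (n : ℕ) (φ : X → ℝ)
    (ω : (ℕ → ℕ → X) × (ℕ → ℕ → ℕ)) : ℝ :=
  gammaHatN G Np n φ ω / gammaHatN G Np n 1 ω

/-- `v̂_{p,n}(φ) = v_{p,n}(φ̂)/η_n(G_n)²`. -/
def vpnHat (M0 : Measure X) (M : ℕ → Kernel X X) (G : ℕ → X → ℝ) (n p : ℕ) (φ : X → ℝ) : ℝ :=
  vpn M0 M G n p (hatf G n φ) / eInt M0 M G n (G n) ^ 2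

/-- `σ̂_n²(φ) = Σ_{p=0}^n c_p⁻¹ v̂_{p,n}(φ)`. -/
def sigma2Hat (M0 : Measure X) (M : ℕ → Kernel X X) (G : ℕ → X → ℝ) (c : ℕ → ℝ) (n : ℕ)
    (φ : X → ℝ) : ℝ :=
  ∑ p ∈ Finset.range (n + 1), (c p)⁻¹ * vpnHat M0 M G n p φ

/-- `V̂_n^N(φ) = V_n^N(φ̂)/η_n^N(G_n)²`. -/
def VestHat (G : ℕ → X → ℝ) (Np : ℕ → ℕ) (n : ℕ) (φ : X → ℝ)
    (ω : (ℕ → ℕ → X) × (ℕ → ℕ → ℕ)) : ℝ :=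
  Vest Np n (hatf G n φ) ω / etaN Np n (G n) ω ^ 2

/-- `v̂_{p,n}^N(φ) = v_{p,n}^N(φ̂)/η_n^N(G_n)²`. -/
def vpnHatN (G : ℕ → X → ℝ) (Np : ℕ → ℕ) (n p : ℕ) (φ : X → ℝ)
    (ω : (ℕ → ℕ → X) × (ℕ → ℕ → ℕ)) : ℝ :=
  vpnN G Np n p (hatf G n φ) ω / etaN Np n (G n) ω ^ 2

/-- `v̂_n^N(φ) = Σ_{p=0}^n c_p⁻¹ v̂_{p,n}^N(φ)`. -/
def vnHatN (G : ℕ → X → ℝ) (Np : ℕ → ℕ) (c : ℕ → ℝ) (n : ℕ) (φ : X → ℝ)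
    (ω : (ℕ → ℕ → X) × (ℕ → ℕ → ℕ)) : ℝ :=
  ∑ p ∈ Finset.range (n + 1), (c p)⁻¹ * vpnHatN G Np n p φ ω


section Preliminaries

variable {Ω α β γ : Type*} [MeasurableSpace Ω] [MeasurableSpace α] [MeasurableSpace β]
  [MeasurableSpace γ]

/-- Bounded measurable real-valued functions. -/
structure BddMeas (f : Ω → ℝ) : Prop where
  measurable : Measurable f
  bounded : ∃ C, ∀ x, |f x| ≤ C

namespace BddMeas

variable {f g : Ω → ℝ}

lemma exists_bound_nonneg (hf : BddMeas f) : ∃ C, 0 ≤ C ∧ ∀ x, |f x| ≤ C := by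
  obtain ⟨C, hC⟩ := hf.bounded
  exact ⟨max C 0, le_max_right _ _, fun x => (hC x).trans (le_max_left _ _)⟩

lemma const (c : ℝ) : BddMeas fun _ : Ω => c :=
  ⟨measurable_const, |c|, fun _ => le_rfl⟩

lemma comp (hf : BddMeas f) {h : α → Ω} (hh : Measurable h) : BddMeas fun a => f (h a) :=
  ⟨hf.measurable.comp hh, hf.bounded.imp fun _ hC a => hC (h a)⟩

lemma add (hf : BddMeas f) (hg : BddMeas g) : BddMeas fun x => f x + g x := by
  obtain ⟨C, hC⟩ := hf.bounded
  obtain ⟨D, hD⟩ := hg.bounded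
  exact ⟨hf.measurable.add hg.measurable, C + D,
    fun x => (abs_add_le _ _).trans (add_le_add (hC x) (hD x))⟩

lemma mul (hf : BddMeas f) (hg : BddMeas g) : BddMeas fun x => f x * g x := by
  obtain ⟨C, hC0, hC⟩ := hf.exists_bound_nonneg
  obtain ⟨D, hD⟩ := hg.bounded
  refine ⟨hf.measurable.mul hg.measurable, C * D, fun x => ?_⟩
  rw [abs_mul]
  exact mul_le_mul (hC x) (hD x) (abs_nonneg _) hC0

lemma const_mul (c : ℝ) (hf : BddMeas f) : BddMeas fun x => c * f x := (const c).mul hf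

lemma sub (hf : BddMeas f) (hg : BddMeas g) : BddMeas fun x => f x - g x := by
  simpa [sub_eq_add_neg] using hf.add (hg.const_mul (-1))

lemma div_const (hf : BddMeas f) (c : ℝ) : BddMeas fun x => f x / c := by
  simpa [div_eq_inv_mul] using hf.const_mul c⁻¹

lemma pow (hf : BddMeas f) (k : ℕ) : BddMeas fun x => f x ^ k := by
  induction k with
  | zero => simpa using const (Ω := Ω) 1
  | succ k ih => simpa [pow_succ] using ih.mul hf

lemma sum {ι : Type*} (s : Finset ι) {F : ι → Ω → ℝ} (hF : ∀ i ∈ s, BddMeas (F i)) :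
    BddMeas fun x => ∑ i ∈ s, F i x := by
  induction s using Finset.induction_on with
  | empty => simpa using const (Ω := Ω) 0
  | insert a s ha ih =>
    simp only [Finset.sum_insert ha]
    exact (hF a (Finset.mem_insert_self a s)).add
      (ih fun i hi => hF i (Finset.mem_insert_of_mem hi))

lemma prod {ι : Type*} (s : Finset ι) {F : ι → Ω → ℝ} (hF : ∀ i ∈ s, BddMeas (F i)) :
    BddMeas fun x => ∏ i ∈ s, F i x := by
  induction s using Finset.induction_on with
  | empty => simpa using const (Ω := Ω) 1
  | insert a s ha ih =>
    simp only [Finset.prod_insert ha]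
    exact (hF a (Finset.mem_insert_self a s)).mul
      (ih fun i hi => hF i (Finset.mem_insert_of_mem hi))

lemma integrable (hf : BddMeas f) (μ : Measure Ω) [IsFiniteMeasure μ] : Integrable f μ := by
  obtain ⟨C, hC⟩ := hf.bounded
  exact Integrable.of_bound hf.measurable.aestronglyMeasurable C (Eventually.of_forall hC)

lemma integral_kernel (hf : BddMeas f) (κ : Kernel α Ω) [IsMarkovKernel κ] :
    BddMeas fun a => ∫ y, f y ∂(κ a) := by
  obtain ⟨C, hC⟩ := hf.bounded
  refine ⟨hf.measurable.stronglyMeasurable.integral_kernel.measurable, C, fun a => ?_⟩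
  simpa using norm_integral_le_of_norm_le_const (μ := κ a) (f := f) (C := C) (Eventually.of_forall hC)

end BddMeas

lemma abs_integral_le_of_abs_le {μ : Measure Ω} [IsProbabilityMeasure μ] {f : Ω → ℝ} {C : ℝ}
    (hf : ∀ x, |f x| ≤ C) : |∫ x, f x ∂μ| ≤ C := by
  simpa using norm_integral_le_of_norm_le_const (μ := μ) (f := f) (C := C) (Eventually.of_forall hf)

lemma integral_bind_of_bddMeas {μ : Measure α} [IsFiniteMeasure μ] {κ : α → Measure β}
    (hκ : Measurable κ) [∀ a, IsProbabilityMeasure (κ a)] {f : β → ℝ} (hf : BddMeas f) :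
    ∫ y, f y ∂(μ.bind κ) = ∫ a, ∫ y, f y ∂(κ a) ∂μ := by
  let K : Kernel α β := ⟨κ, hκ⟩
  have : IsMarkovKernel K := ⟨fun a => inferInstanceAs (IsProbabilityMeasure (κ a))⟩
  change ∫ y, f y ∂(K ∘ₘ μ) = ∫ a, ∫ y, f y ∂(K a) ∂μ
  have h : Integrable f (K ∘ₘ μ) := hf.integrable _
  rw [Measure.comp_eq_comp_const_apply] at h ⊢
  rw [Kernel.integral_comp h, Kernel.const_apply]

lemma measurable_map_of_measurable_uncurry {κ : α → Measure β} (hκ : Measurable κ)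
    [∀ a, IsProbabilityMeasure (κ a)] {f : α → β → γ} (hf : Measurable (Function.uncurry f)) :
    Measurable fun a => (κ a).map (f a) := by
  let K : Kernel α β := ⟨κ, hκ⟩
  have : IsMarkovKernel K := ⟨fun a => inferInstanceAs (IsProbabilityMeasure (κ a))⟩
  refine Measure.measurable_of_measurable_coe _ fun s hs => ?_
  have h : ∀ a, (κ a).map (f a) s = K a (Prod.mk a ⁻¹' (Function.uncurry f ⁻¹' s)) := fun a => by
    rw [Measure.map_apply (f := f a) (hf.comp measurable_prodMk_left) hs]
    rfl
  simp_rw [h]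
  exact Kernel.measurable_kernel_prodMk_left (hf hs)

lemma measurable_pi_of_measurable {ι : Type*} [Fintype ι] {κ : α → Measure β}
    (hκ : Measurable κ) [∀ a, IsProbabilityMeasure (κ a)] :
    Measurable fun a => Measure.pi fun _ : ι => κ a := by
  refine Measurable.measure_of_isPiSystem_of_isProbabilityMeasure generateFrom_pi.symm
    isPiSystem_pi ?_
  rintro _ ⟨t, ht, rfl⟩
  simp only [Measure.pi_pi]
  exact Finset.measurable_prod _ fun i _ => (Measure.measurable_coe (ht i trivial)).comp hκ

section IID

variable {μ : Measure α} [IsProbabilityMeasure μ] {m : ℕ}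

lemma indepFun_sum_eval {f : α → ℝ} (hf : Measurable f) {s : Finset (Fin m)} {i : Fin m}
    (hi : i ∉ s) :
    IndepFun (fun x : Fin m → α => ∑ j ∈ s, f (x j)) (fun x => f (x i))
      (Measure.pi fun _ => μ) := by
  have h := (iIndepFun_pi (μ := fun _ : Fin m => μ) (X := fun _ => f)
    fun _ => hf.aemeasurable).indepFun_finsetSum_of_notMem
    (fun j => hf.comp (measurable_pi_apply j)) hi
  convert h using 1
  ext x
  simp

lemma moments_sum_eval {f : α → ℝ} (hf : Measurable f) {C : ℝ} (hC : ∀ x, |f x| ≤ C)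
    (h0 : ∫ x, f x ∂μ = 0) (s : Finset (Fin m)) :
    ∫ x, (∑ j ∈ s, f (x j)) ∂(Measure.pi fun _ : Fin m => μ) = 0 ∧
    ∫ x, (∑ j ∈ s, f (x j)) ^ 2 ∂(Measure.pi fun _ : Fin m => μ) = s.card * ∫ x, f x ^ 2 ∂μ ∧
    ∫ x, (∑ j ∈ s, f (x j)) ^ 4 ∂(Measure.pi fun _ : Fin m => μ) ≤
      3 * (s.card : ℝ) ^ 2 * C ^ 4 := by
  set P := Measure.pi fun _ : Fin m => μ with hP
  have hfB : BddMeas f := ⟨hf, C, hC⟩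
  induction s using Finset.induction_on with
  | empty => simp
  | insert i s hi ih =>
    obtain ⟨ih1, ih2, ih4⟩ := ih
    set S : (Fin m → α) → ℝ := fun x => ∑ j ∈ s, f (x j) with hS
    set Y : (Fin m → α) → ℝ := fun x => f (x i) with hY
    replace ih2 : ∫ x, S x ^ 2 ∂P = s.card * ∫ x, f x ^ 2 ∂μ := ih2
    replace ih4 : ∫ x, S x ^ 4 ∂P ≤ 3 * (s.card : ℝ) ^ 2 * C ^ 4 := ih4
    have hSB : BddMeas S := BddMeas.sum s fun j _ => hfB.comp (measurable_pi_apply j)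
    have hYB : BddMeas Y := hfB.comp (measurable_pi_apply i)
    have hind : IndepFun S Y P := indepFun_sum_eval hf hi
    have hmul : ∀ a b : ℕ, ∫ x, S x ^ a * Y x ^ b ∂P = (∫ x, S x ^ a ∂P) * ∫ x, Y x ^ b ∂P :=
      fun a b => (hind.comp (φ := fun t => t ^ a) (ψ := fun t => t ^ b) (by fun_prop)
        (by fun_prop)).integral_fun_mul_eq_mul_integral
        (hSB.pow a).measurable.aestronglyMeasurable (hYB.pow b).measurable.aestronglyMeasurable
    have hYp : ∀ b : ℕ, ∫ x, Y x ^ b ∂P = ∫ x, f x ^ b ∂μ := fun b =>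
      integral_comp_eval (μ := fun _ : Fin m => μ) (i := i) (f := fun t => f t ^ b)
        (hfB.pow b).measurable.aestronglyMeasurable
    have hB : ∀ a b : ℕ, BddMeas (fun x => S x ^ a * Y x ^ b) := fun a b =>
      (hSB.pow a).mul (hYB.pow b)
    have hY1 : ∫ x, Y x ∂P = 0 := by simpa [h0] using hYp 1
    have hC0 : 0 ≤ C := (abs_nonneg _).trans (hC (Classical.choice μ.nonempty_of_neZero))
    have hv2 : ∫ x, f x ^ 2 ∂μ ≤ C ^ 2 :=
      (le_abs_self _).trans (abs_integral_le_of_abs_le fun x => by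
        rw [abs_pow]; exact pow_le_pow_left₀ (abs_nonneg _) (hC x) 2)
    have hv4 : ∫ x, f x ^ 4 ∂μ ≤ C ^ 4 :=
      (le_abs_self _).trans (abs_integral_le_of_abs_le fun x => by
        rw [abs_pow]; exact pow_le_pow_left₀ (abs_nonneg _) (hC x) 4)
    have hv0 : 0 ≤ ∫ x, f x ^ 2 ∂μ := integral_nonneg fun x => sq_nonneg _
    simp only [Finset.sum_insert hi, Finset.card_insert_of_notMem hi]
    change ∫ x, (Y x + S x) ∂P = 0 ∧ ∫ x, (Y x + S x) ^ 2 ∂P = _ ∧ ∫ x, (Y x + S x) ^ 4 ∂P ≤ _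
    have e2 : ∀ x, (Y x + S x) ^ 2 = S x ^ 2 * Y x ^ 0 + 2 * (S x ^ 1 * Y x ^ 1)
        + S x ^ 0 * Y x ^ 2 := fun x => by ring
    have e4 : ∀ x, (Y x + S x) ^ 4 = S x ^ 4 * Y x ^ 0 + 4 * (S x ^ 3 * Y x ^ 1)
        + 6 * (S x ^ 2 * Y x ^ 2) + 4 * (S x ^ 1 * Y x ^ 3) + S x ^ 0 * Y x ^ 4 := fun x => by ring
    refine ⟨?_, ?_, ?_⟩
    · rw [integral_add (hYB.integrable P) (hSB.integrable P), hY1, ih1, add_zero]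
    · simp_rw [e2]
      rw [integral_add (((hB 2 0).add ((hB 1 1).const_mul 2)).integrable P)
          ((hB 0 2).integrable P),
        integral_add ((hB 2 0).integrable P) (((hB 1 1).const_mul 2).integrable P),
        integral_const_mul, hmul, hmul, hmul, hYp 2]
      simp only [pow_one, pow_zero, hY1, ih2, integral_const, probReal_univ, smul_eq_mul]
      push_cast
      ring
    · simp_rw [e4]
      have h1 := (hB 4 0).add ((hB 3 1).const_mul 4)
      have h2 := h1.add ((hB 2 2).const_mul 6)
      have h3 := h2.add ((hB 1 3).const_mul 4)
      rw [integral_add (h3.integrable P) ((hB 0 4).integrable P),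
        integral_add (h2.integrable P) (((hB 1 3).const_mul 4).integrable P),
        integral_add (h1.integrable P) (((hB 2 2).const_mul 6).integrable P),
        integral_add ((hB 4 0).integrable P) (((hB 3 1).const_mul 4).integrable P),
        integral_const_mul, integral_const_mul, integral_const_mul,
        hmul, hmul, hmul, hmul, hmul, hYp 2, hYp 4]
      simp only [pow_one, pow_zero, hY1, ih1, ih2, integral_const, probReal_univ, smul_eq_mul]
      have hvv : (∫ x, f x ^ 2 ∂μ) * (∫ x, f x ^ 2 ∂μ) ≤ C ^ 4 := by
        calc _ ≤ C ^ 2 * C ^ 2 := mul_le_mul hv2 hv2 hv0 (by positivity)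
          _ = C ^ 4 := by ring
      have hs : (0 : ℝ) ≤ s.card := Nat.cast_nonneg _
      have := mul_le_mul_of_nonneg_left hvv hs
      push_cast
      nlinarith [pow_nonneg hC0 4]

variable {φ : α → ℝ}

lemma integral_mean_eval (hm : 0 < m) (hφ : BddMeas φ) :
    ∫ x, (m : ℝ)⁻¹ * ∑ j, φ (x j) ∂(Measure.pi fun _ : Fin m => μ) = ∫ x, φ x ∂μ := by
  have hm' : (m : ℝ) ≠ 0 := by positivity
  rw [integral_const_mul, integral_finsetSum _ fun j _ =>
    (hφ.comp (measurable_pi_apply j)).integrable _]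
  have h : ∀ j : Fin m, ∫ x, φ (x j) ∂(Measure.pi fun _ : Fin m => μ) = ∫ x, φ x ∂μ := fun j =>
    integral_comp_eval (μ := fun _ : Fin m => μ) hφ.measurable.aestronglyMeasurable
  simp [h, hm']

lemma mean_sub_eq (hm : 0 < m) (a : ℝ) (y : Fin m → ℝ) :
    (m : ℝ)⁻¹ * ∑ j, y j - a = (m : ℝ)⁻¹ * ∑ j, (y j - a) := by
  have hm' : (m : ℝ) ≠ 0 := by positivity
  rw [Finset.sum_sub_distrib]
  simp
  field_simp

lemma integral_sub_integral_eq_zero (hφ : BddMeas φ) :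
    ∫ x, (φ x - ∫ y, φ y ∂μ) ∂μ = 0 := by
  rw [integral_sub (hφ.integrable μ) (integrable_const _)]
  simp

lemma integral_mean_eval_sq (hm : 0 < m) (hφ : BddMeas φ) :
    ∫ x, ((m : ℝ)⁻¹ * ∑ j, φ (x j)) ^ 2 ∂(Measure.pi fun _ : Fin m => μ) =
      (∫ x, φ x ∂μ) ^ 2 + (m : ℝ)⁻¹ * (∫ x, φ x ^ 2 ∂μ - (∫ x, φ x ∂μ) ^ 2) := by
  have hm' : (m : ℝ) ≠ 0 := by positivity
  set a := ∫ x, φ x ∂μ with ha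
  have hψ : BddMeas fun x => φ x - a := hφ.sub (BddMeas.const a)
  obtain ⟨C, hC⟩ := hψ.bounded
  obtain ⟨h1, h2, -⟩ := moments_sum_eval (μ := μ) hψ.measurable hC
    (integral_sub_integral_eq_zero hφ) (Finset.univ : Finset (Fin m))
  have hB : BddMeas fun x : Fin m → α => ∑ j, (φ (x j) - a) :=
    BddMeas.sum _ fun j _ => hψ.comp (measurable_pi_apply j)
  have e : ∀ x : Fin m → α, ((m : ℝ)⁻¹ * ∑ j, φ (x j)) ^ 2 =
      (m : ℝ)⁻¹ ^ 2 * (∑ j, (φ (x j) - a)) ^ 2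
        + (2 * a * (m : ℝ)⁻¹ * ∑ j, (φ (x j) - a) + a ^ 2) := fun x => by
    have := mean_sub_eq hm a fun j => φ (x j)
    rw [← sub_add_cancel ((m : ℝ)⁻¹ * ∑ j, φ (x j)) a, this]
    ring
  have ev : ∫ x, (φ x - a) ^ 2 ∂μ = ∫ x, φ x ^ 2 ∂μ - a ^ 2 := by
    have e' : ∀ x, (φ x - a) ^ 2 = φ x ^ 2 - (2 * a * φ x - a ^ 2) := fun x => by ring
    simp_rw [e']
    rw [integral_sub ((hφ.pow 2).integrable μ)
      (((hφ.const_mul (2 * a)).sub (BddMeas.const _)).integrable μ),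
      integral_sub ((hφ.const_mul (2 * a)).integrable μ) (integrable_const _),
      integral_const_mul, ← ha]
    simp
    ring
  simp_rw [e]
  rw [integral_add (((hB.pow 2).const_mul _).integrable _)
      (((hB.const_mul _).add (BddMeas.const _)).integrable _),
    integral_add ((hB.const_mul _).integrable _) (integrable_const _),
    integral_const_mul, integral_const_mul, h1, h2, ev]
  simp
  field_simp
  ring

lemma integral_mean_eval_sub_pow_four_le (hm : 0 < m) (hφ : Measurable φ) {C : ℝ}
    (hC : ∀ x, |φ x| ≤ C) :
    ∫ x, ((m : ℝ)⁻¹ * ∑ j, φ (x j) - ∫ y, φ y ∂μ) ^ 4 ∂(Measure.pi fun _ : Fin m => μ) ≤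
      48 * C ^ 4 / (m : ℝ) ^ 2 := by
  have hm' : (0 : ℝ) < m := by positivity
  set a := ∫ x, φ x ∂μ with ha
  have hφB : BddMeas φ := ⟨hφ, C, hC⟩
  have haC : |a| ≤ C := abs_integral_le_of_abs_le hC
  have hψ : ∀ x, |φ x - a| ≤ 2 * C := fun x => by
    have := abs_sub (φ x) a
    linarith [hC x]
  obtain ⟨-, -, h4⟩ := moments_sum_eval (μ := μ) (hφ.sub_const a) hψ
    (integral_sub_integral_eq_zero hφB) (Finset.univ : Finset (Fin m))
  simp_rw [mean_sub_eq hm, mul_pow]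
  rw [integral_const_mul]
  calc _ ≤ (m : ℝ)⁻¹ ^ 4 * (3 * ((Finset.univ : Finset (Fin m)).card : ℝ) ^ 2 * (2 * C) ^ 4) :=
        mul_le_mul_of_nonneg_left h4 (by positivity)
    _ = 48 * C ^ 4 / (m : ℝ) ^ 2 := by
        simp
        field_simp
        ring

end IID

end Preliminaries

section ParticleSystem

section Categorical

variable {β : Type*} [MeasurableSpace β] {m : ℕ} {w : ℕ → ℝ}

lemma cat_bind (m : ℕ) (w : ℕ → ℝ) (κ : ℕ → Measure β) :
    (cat m w).bind κ = (∑ j ∈ Finset.range m, ENNReal.ofReal (w j))⁻¹ •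
      ∑ j ∈ Finset.range m, ENNReal.ofReal (w j) • κ j := by
  ext s hs
  rw [Measure.bind_apply hs measurable_from_nat.aemeasurable]
  simp [cat, lintegral_finsetSum_measure, lintegral_smul_measure]

lemma sum_ofReal_ne_zero (hm : 0 < m) (hw : ∀ j, 0 < w j) :
    ∑ j ∈ Finset.range m, ENNReal.ofReal (w j) ≠ 0 := by
  intro h
  rw [Finset.sum_eq_zero_iff] at h
  exact (ENNReal.ofReal_pos.2 (hw 0)).ne' (h 0 (Finset.mem_range.2 hm))

lemma sum_ofReal_ne_top : ∑ j ∈ Finset.range m, ENNReal.ofReal (w j) ≠ ⊤ :=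
  ENNReal.sum_ne_top.2 fun _ _ => ENNReal.ofReal_ne_top

lemma isProbabilityMeasure_cat_bind (hm : 0 < m) (hw : ∀ j, 0 < w j) (κ : ℕ → Measure β)
    [∀ j, IsProbabilityMeasure (κ j)] : IsProbabilityMeasure ((cat m w).bind κ) := by
  refine ⟨?_⟩
  simp only [cat_bind, Measure.smul_apply, Measure.finsetSum_apply, measure_univ, smul_eq_mul,
    mul_one]
  exact ENNReal.inv_mul_cancel (sum_ofReal_ne_zero hm hw) sum_ofReal_ne_top

lemma measurable_cat_bind {α : Type*} [MeasurableSpace α] {w : α → ℕ → ℝ}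
    {κ : α → ℕ → Measure β} (hw : ∀ j, Measurable fun a => w a j)
    (hκ : ∀ j, Measurable fun a => κ a j) :
    Measurable fun a => (cat m (w a)).bind (κ a) := by
  refine Measure.measurable_of_measurable_coe _ fun s hs => ?_
  simp only [cat_bind, Measure.smul_apply, Measure.finsetSum_apply, smul_eq_mul]
  refine (Finset.measurable_sum _ fun j _ => (hw j).ennreal_ofReal).inv.mul
    (Finset.measurable_sum _ fun j _ => (hw j).ennreal_ofReal.mul ?_)
  exact (Measure.measurable_coe hs).comp (hκ j)

lemma integral_cat_bind (hw : ∀ j, 0 < w j) (κ : ℕ → Measure β)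
    [∀ j, IsProbabilityMeasure (κ j)] {f : β → ℝ} (hf : BddMeas f) :
    ∫ y, f y ∂((cat m w).bind κ) =
      (∑ j ∈ Finset.range m, w j * ∫ y, f y ∂(κ j)) / ∑ j ∈ Finset.range m, w j := by
  rw [cat_bind, integral_smul_measure, integral_finsetSum_measure fun j _ =>
    (hf.integrable (κ j)).smul_measure ENNReal.ofReal_ne_top, ENNReal.toReal_inv,
    ENNReal.toReal_sum fun _ _ => ENNReal.ofReal_ne_top]
  simp only [integral_smul_measure, ENNReal.toReal_ofReal (hw _).le, smul_eq_mul]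
  rw [div_eq_inv_mul]

end Categorical

lemma measurable_padF {Y : Type*} [MeasurableSpace Y] [Nonempty Y] {m : ℕ} :
    Measurable (padF : (Fin m → Y) → ℕ → Y) := by
  refine measurable_pi_lambda _ fun i => ?_
  by_cases h : i < m
  · simpa [padF, h] using measurable_pi_apply _
  · simp [padF, h]

/-- Positive, bounded, measurable potentials. -/
structure Admissible (G : ℕ → X → ℝ) : Prop where
  bddMeas : ∀ p, BddMeas (G p)
  pos : ∀ p x, 0 < G p x

/-- The law of an (ancestor index, new particle) pair given the current configuration. -/
def selectMutate (M : ℕ → Kernel X X) (G : ℕ → X → ℝ) (Np : ℕ → ℕ) (p : ℕ) (z : ℕ → X) :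
    Measure (ℕ × X) :=
  (cat (Np p) fun j => G p (z j)).bind fun a => (M (p + 1) (z a)).map fun x => (a, x)

/-- The law of a new particle given the current configuration. -/
def predict (M : ℕ → Kernel X X) (G : ℕ → X → ℝ) (Np : ℕ → ℕ) (p : ℕ) (z : ℕ → X) :
    Measure X :=
  (cat (Np p) fun j => G p (z j)).bind fun a => M (p + 1) (z a)

/-- The Feynman–Kac transition `Q_{p+1}(φ) = G_p M_{p+1}(φ)`. -/
def fkStep (M : ℕ → Kernel X X) (G : ℕ → X → ℝ) (p : ℕ) (φ : X → ℝ) : X → ℝ :=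
  fun x => G p x * ∫ y, φ y ∂(M (p + 1) x)

/-- The integral of `φ` against the predictive law of a particle of generation `p + 1`. -/
def predictMean (M : ℕ → Kernel X X) (G : ℕ → X → ℝ) (Np : ℕ → ℕ) (p : ℕ) (φ : X → ℝ)
    (ω : (ℕ → ℕ → X) × (ℕ → ℕ → ℕ)) : ℝ :=
  etaN Np p (fkStep M G p φ) ω / etaN Np p (G p) ω

/-- Functionals of the particle system that only depend on generations `0, …, k`. -/
def DependsUpTo (k : ℕ) (F : (ℕ → ℕ → X) × (ℕ → ℕ → ℕ) → ℝ) : Prop :=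
  ∀ ω ω' : (ℕ → ℕ → X) × (ℕ → ℕ → ℕ), (∀ p ≤ k, ω.1 p = ω'.1 p) → F ω = F ω'

variable {M0 : Measure X} [IsProbabilityMeasure M0] {M : ℕ → Kernel X X}
  [∀ p, IsMarkovKernel (M p)] {G : ℕ → X → ℝ} {Np : ℕ → ℕ} {φ : X → ℝ}

omit [MeasurableSpace X] in
lemma DependsUpTo.mono {k l : ℕ} (hkl : k ≤ l) {F : (ℕ → ℕ → X) × (ℕ → ℕ → ℕ) → ℝ}
    (hF : DependsUpTo k F) : DependsUpTo l F :=
  fun ω ω' h => hF ω ω' fun p hp => h p (hp.trans hkl)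

omit [MeasurableSpace X] in
lemma dependsUpTo_etaN (Np : ℕ → ℕ) (p : ℕ) (φ : X → ℝ) : DependsUpTo p (etaN Np p φ) :=
  fun ω ω' h => by simp [etaN, h p le_rfl]

lemma bddMeas_fkStep (hG : Admissible G) (hφ : BddMeas φ) (p : ℕ) :
    BddMeas (fkStep M G p φ) :=
  (hG.bddMeas p).mul (hφ.integral_kernel (M (p + 1)))

lemma measurable_particle (p i : ℕ) :
    Measurable fun ω : (ℕ → ℕ → X) × (ℕ → ℕ → ℕ) => ω.1 p i :=
  (measurable_pi_apply i).comp ((measurable_pi_apply p).comp measurable_fst)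

lemma bddMeas_etaN (hφ : BddMeas φ) (Np : ℕ → ℕ) (p : ℕ) : BddMeas (etaN Np p φ) :=
  (BddMeas.sum _ fun i _ => hφ.comp (measurable_particle p i)).const_mul _

lemma etaN_pos (hG : Admissible G) (hNp : ∀ p, 0 < Np p) (p : ℕ)
    (ω : (ℕ → ℕ → X) × (ℕ → ℕ → ℕ)) : 0 < etaN Np p (G p) ω :=
  mul_pos (inv_pos.2 (Nat.cast_pos.2 (hNp p)))
    (Finset.sum_pos (fun _ _ => hG.pos p _) (Finset.nonempty_range_iff.2 (hNp p).ne'))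

omit [MeasurableSpace X] in
lemma abs_etaN_le (hNp : ∀ p, 0 < Np p) {C : ℝ} (hC : ∀ x, |φ x| ≤ C) (p : ℕ)
    (ω : (ℕ → ℕ → X) × (ℕ → ℕ → ℕ)) : |etaN Np p φ ω| ≤ C := by
  have h : (0 : ℝ) < Np p := Nat.cast_pos.2 (hNp p)
  rw [etaN, abs_mul, abs_inv, abs_of_pos h, inv_mul_le_iff₀ h]
  calc _ ≤ ∑ i ∈ Finset.range (Np p), |φ (ω.1 p i)| := Finset.abs_sum_le_sum_abs _ _
    _ ≤ ∑ _i ∈ Finset.range (Np p), C := Finset.sum_le_sum fun _ _ => hC _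
    _ = Np p * C := by simp

lemma isProbabilityMeasure_selectMutate (hG : Admissible G) (hNp : ∀ p, 0 < Np p) (p : ℕ)
    (z : ℕ → X) : IsProbabilityMeasure (selectMutate M G Np p z) := by
  have : ∀ a : ℕ, IsProbabilityMeasure ((M (p + 1) (z a)).map fun x => (a, x)) := fun a =>
    Measure.isProbabilityMeasure_map measurable_prodMk_left.aemeasurable
  exact isProbabilityMeasure_cat_bind (hNp p) (fun _ => hG.pos p _) _

lemma isProbabilityMeasure_predict (hG : Admissible G) (hNp : ∀ p, 0 < Np p) (p : ℕ)
    (z : ℕ → X) : IsProbabilityMeasure (predict M G Np p z) :=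
  isProbabilityMeasure_cat_bind (hNp p) (fun _ => hG.pos p _) _

omit [∀ (p : ℕ), IsMarkovKernel (M p)] in
lemma measurable_selectMutate (hG : Admissible G) (p : ℕ) :
    Measurable (selectMutate M G Np p) := by
  refine measurable_cat_bind
    (fun j => (hG.bddMeas p).measurable.comp (measurable_pi_apply j)) fun j => ?_
  exact (Measure.measurable_map _ measurable_prodMk_left).comp
    ((M (p + 1)).measurable.comp (measurable_pi_apply j))

omit [∀ (p : ℕ), IsMarkovKernel (M p)] in
lemma map_snd_selectMutate (p : ℕ) (z : ℕ → X) :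
    (selectMutate M G Np p z).map Prod.snd = predict M G Np p z := by
  ext s hs
  rw [Measure.map_apply measurable_snd hs, selectMutate, predict,
    Measure.bind_apply (measurable_snd hs) measurable_from_nat.aemeasurable,
    Measure.bind_apply hs measurable_from_nat.aemeasurable]
  refine lintegral_congr fun a => ?_
  rw [Measure.map_apply measurable_prodMk_left (measurable_snd hs)]
  rfl

lemma integral_predict (hG : Admissible G) (hNp : ∀ p, 0 < Np p) (hφ : BddMeas φ) (p : ℕ)
    (ω : (ℕ → ℕ → X) × (ℕ → ℕ → ℕ)) :
    ∫ x, φ x ∂(predict M G Np p (ω.1 p)) = predictMean M G Np p φ ω := by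
  have h : ((Np p : ℝ)⁻¹) ≠ 0 := inv_ne_zero (Nat.cast_ne_zero.2 (hNp p).ne')
  rw [predict, integral_cat_bind (fun j => hG.pos p _) _ hφ, predictMean, etaN, etaN,
    mul_div_mul_left _ _ h]
  rfl

lemma abs_predictMean_le (hG : Admissible G) (hNp : ∀ p, 0 < Np p) (hφ : Measurable φ) {C : ℝ}
    (hC : ∀ x, |φ x| ≤ C) (p : ℕ) (ω : (ℕ → ℕ → X) × (ℕ → ℕ → ℕ)) :
    |predictMean M G Np p φ ω| ≤ C := by
  have := isProbabilityMeasure_predict (M := M) hG hNp p (ω.1 p)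
  rw [← integral_predict hG hNp ⟨hφ, C, hC⟩]
  exact abs_integral_le_of_abs_le hC

lemma bddMeas_predictMean (hG : Admissible G) (hNp : ∀ p, 0 < Np p) (hφ : BddMeas φ) (p : ℕ) :
    BddMeas (predictMean M G Np p φ) := by
  obtain ⟨C, hC⟩ := hφ.bounded
  exact ⟨(bddMeas_etaN (bddMeas_fkStep hG hφ p) Np p).measurable.div
    (bddMeas_etaN (hG.bddMeas p) Np p).measurable, C,
    abs_predictMean_le hG hNp hφ.measurable hC p⟩

omit [∀ (p : ℕ), IsMarkovKernel (M p)] in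
lemma dependsUpTo_predictMean (p : ℕ) : DependsUpTo p (predictMean M G Np p φ) :=
  fun ω ω' h => congrArg₂ (· / ·) (dependsUpTo_etaN Np p _ ω ω' h)
    (dependsUpTo_etaN Np p _ ω ω' h)

variable [Nonempty X]

lemma measurable_padF_pair {m : ℕ} : Measurable fun f : Fin m → ℕ × X =>
    ((padF fun i => (f i).1 : ℕ → ℕ), (padF fun i => (f i).2 : ℕ → X)) := by
  refine (measurable_padF.comp ?_).prodMk (measurable_padF.comp ?_)
  · exact measurable_pi_lambda _ fun i => measurable_fst.comp (measurable_pi_apply i)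
  · exact measurable_pi_lambda _ fun i => measurable_snd.comp (measurable_pi_apply i)

lemma isProbabilityMeasure_pfStep (hG : Admissible G) (hNp : ∀ p, 0 < Np p) (p : ℕ)
    (z : ℕ → X) : IsProbabilityMeasure (pfStep M G Np p z) := by
  have := isProbabilityMeasure_selectMutate (M := M) hG hNp p z
  exact Measure.isProbabilityMeasure_map
    (μ := Measure.pi fun _ : Fin (Np (p + 1)) => selectMutate M G Np p z)
    measurable_padF_pair.aemeasurable

lemma measurable_pfStep (hG : Admissible G) (hNp : ∀ p, 0 < Np p) (p : ℕ) :
    Measurable (pfStep M G Np p) := by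
  have := isProbabilityMeasure_selectMutate (M := M) hG hNp p
  exact (Measure.measurable_map _ measurable_padF_pair).comp
    (measurable_pi_of_measurable (κ := selectMutate M G Np p) (ι := Fin (Np (p + 1)))
      (measurable_selectMutate hG p))

omit [Nonempty X] in
lemma measurable_update_pair (k : ℕ) : Measurable (Function.uncurry
    fun (ω : (ℕ → ℕ → X) × (ℕ → ℕ → ℕ)) (az : (ℕ → ℕ) × (ℕ → X)) =>
      (Function.update ω.1 (k + 1) az.2, Function.update ω.2 k az.1)) := by
  refine Measurable.prodMk ?_ ?_
  · exact measurable_update'.comp ((measurable_fst.comp measurable_fst).prodMk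
      (measurable_snd.comp measurable_snd))
  · exact measurable_update'.comp ((measurable_snd.comp measurable_fst).prodMk
      (measurable_fst.comp measurable_snd))

lemma measurable_pfKernel (hG : Admissible G) (hNp : ∀ p, 0 < Np p) (k : ℕ) :
    Measurable fun ω : (ℕ → ℕ → X) × (ℕ → ℕ → ℕ) =>
      (pfStep M G Np k (ω.1 k)).map fun az =>
        (Function.update ω.1 (k + 1) az.2, Function.update ω.2 k az.1) := by
  have : ∀ ω : (ℕ → ℕ → X) × (ℕ → ℕ → ℕ), IsProbabilityMeasure (pfStep M G Np k (ω.1 k)) :=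
    fun ω => isProbabilityMeasure_pfStep hG hNp k _
  exact measurable_map_of_measurable_uncurry
    (κ := fun ω : (ℕ → ℕ → X) × (ℕ → ℕ → ℕ) => pfStep M G Np k (ω.1 k))
    (f := fun ω az => (Function.update ω.1 (k + 1) az.2, Function.update ω.2 k az.1))
    ((measurable_pfStep hG hNp k).comp ((measurable_pi_apply k).comp measurable_fst))
    (measurable_update_pair k)

lemma isProbabilityMeasure_pfKernel (hG : Admissible G) (hNp : ∀ p, 0 < Np p) (k : ℕ)
    (ω : (ℕ → ℕ → X) × (ℕ → ℕ → ℕ)) :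
    IsProbabilityMeasure ((pfStep M G Np k (ω.1 k)).map fun az =>
        (Function.update ω.1 (k + 1) az.2, Function.update ω.2 k az.1)) := by
  have := isProbabilityMeasure_pfStep (M := M) hG hNp k (ω.1 k)
  exact Measure.isProbabilityMeasure_map
    ((measurable_update_pair k).comp measurable_prodMk_left).aemeasurable

lemma measurable_init {m : ℕ} : Measurable fun f : Fin m → X =>
    ((fun p => if p = 0 then padF f else fun _ => Classical.arbitrary X, fun _ _ => 0) :
      (ℕ → ℕ → X) × (ℕ → ℕ → ℕ)) := by
  refine Measurable.prodMk (measurable_pi_lambda _ fun p => ?_) measurable_const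
  by_cases h : p = 0
  · simpa [h] using measurable_padF
  · simp [h]

lemma isProbabilityMeasure_pfLaw (hG : Admissible G) (hNp : ∀ p, 0 < Np p) (k : ℕ) :
    IsProbabilityMeasure (pfLaw M0 M G Np k) := by
  induction k with
  | zero => exact Measure.isProbabilityMeasure_map measurable_init.aemeasurable
  | succ k ih =>
    exact isProbabilityMeasure_bind (measurable_pfKernel hG hNp k).aemeasurable
      (Eventually.of_forall (isProbabilityMeasure_pfKernel hG hNp k))

lemma integral_pfLaw_succ (hG : Admissible G) (hNp : ∀ p, 0 < Np p) (k : ℕ)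
    {f : (ℕ → ℕ → X) × (ℕ → ℕ → ℕ) → ℝ} (hf : BddMeas f) (hd : DependsUpTo (k + 1) f) :
    ∫ ω, f ω ∂(pfLaw M0 M G Np (k + 1)) =
      ∫ ω, ∫ x, f (Function.update ω.1 (k + 1) (padF x), ω.2)
        ∂(Measure.pi fun _ : Fin (Np (k + 1)) => predict M G Np k (ω.1 k))
        ∂(pfLaw M0 M G Np k) := by
  have := isProbabilityMeasure_pfLaw (M0 := M0) (M := M) hG hNp k
  have := isProbabilityMeasure_pfKernel (M := M) hG hNp k
  rw [pfLaw, integral_bind_of_bddMeas (measurable_pfKernel hG hNp k) hf]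
  refine integral_congr_ae (Eventually.of_forall fun ω => ?_)
  have hsm := isProbabilityMeasure_selectMutate (M := M) hG hNp k (ω.1 k)
  have hpr := isProbabilityMeasure_predict (M := M) hG hNp k (ω.1 k)
  have hu := (measurable_update_pair (X := X) k).comp (measurable_prodMk_left (x := ω))
  have hmap : Measure.pi (fun _ : Fin (Np (k + 1)) => predict M G Np k (ω.1 k)) =
      (Measure.pi fun _ : Fin (Np (k + 1)) => selectMutate M G Np k (ω.1 k)).map
        fun f i => (f i).2 := by
    have hs : ∀ _ : Fin (Np (k + 1)),
        SigmaFinite ((selectMutate M G Np k (ω.1 k)).map Prod.snd) := fun _ => by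
      rw [map_snd_selectMutate]; infer_instance
    rw [Measure.pi_map_pi (f := fun _ => Prod.snd) fun _ => measurable_snd.aemeasurable]
    simp_rw [map_snd_selectMutate]
  have hsnd : Measurable fun (f : Fin (Np (k + 1)) → ℕ × X) i => (f i).2 :=
    measurable_pi_lambda _ fun i => measurable_snd.comp (measurable_pi_apply i)
  have hu' : Measurable fun x : Fin (Np (k + 1)) → X =>
      ((Function.update ω.1 (k + 1) (padF x), ω.2) : (ℕ → ℕ → X) × (ℕ → ℕ → ℕ)) :=
    ((measurable_update ω.1).comp measurable_padF).prodMk measurable_const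
  dsimp only
  rw [hmap, integral_map hsnd.aemeasurable
    (f := fun x => f (Function.update ω.1 (k + 1) (padF x), ω.2)) (hf.measurable.comp hu').aestronglyMeasurable]
  rw [integral_map (φ := fun az : (ℕ → ℕ) × (ℕ → X) =>
      (Function.update ω.1 (k + 1) az.2, Function.update ω.2 k az.1)) hu.aemeasurable
      hf.measurable.aestronglyMeasurable,
    pfStep, integral_map (f := fun az : (ℕ → ℕ) × (ℕ → X) =>
      f (Function.update ω.1 (k + 1) az.2, Function.update ω.2 k az.1))
      measurable_padF_pair.aemeasurable
      (hf.measurable.comp hu).aestronglyMeasurable]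
  exact integral_congr_ae (Eventually.of_forall fun x => hd _ _ fun p _ => rfl)

omit [MeasurableSpace X] in
lemma etaN_update (k : ℕ) (ω : (ℕ → ℕ → X) × (ℕ → ℕ → ℕ)) (x : Fin (Np (k + 1)) → X)
    (A : ℕ → ℕ → ℕ) :
    etaN Np (k + 1) φ (Function.update ω.1 (k + 1) (padF x), A) =
      (Np (k + 1) : ℝ)⁻¹ * ∑ j, φ (x j) := by
  simp only [etaN, Function.update_self]
  rw [Finset.sum_range]
  simp [padF]

omit [MeasurableSpace X] [Nonempty X] in
lemma DependsUpTo.apply_update {k : ℕ} {F : (ℕ → ℕ → X) × (ℕ → ℕ → ℕ) → ℝ}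
    (hF : DependsUpTo k F) (ω : (ℕ → ℕ → X) × (ℕ → ℕ → ℕ)) (y : ℕ → X) (A : ℕ → ℕ → ℕ) :
    F (Function.update ω.1 (k + 1) y, A) = F ω :=
  hF _ _ fun p hp => Function.update_of_ne (by omega) _ _

section Moments

variable (hG : Admissible G) (hNp : ∀ p, 0 < Np p) {k : ℕ}
  {F : (ℕ → ℕ → X) × (ℕ → ℕ → ℕ) → ℝ}

include hG hNp

lemma integral_pfLaw_succ_of_dependsUpTo (hF : BddMeas F) (hd : DependsUpTo k F) :
    ∫ ω, F ω ∂(pfLaw M0 M G Np (k + 1)) = ∫ ω, F ω ∂(pfLaw M0 M G Np k) := by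
  rw [integral_pfLaw_succ hG hNp k hF (hd.mono k.le_succ)]
  refine integral_congr_ae (Eventually.of_forall fun ω => ?_)
  have := isProbabilityMeasure_predict (M := M) hG hNp k (ω.1 k)
  simp [hd.apply_update]

lemma integral_pfLaw_of_dependsUpTo (hF : BddMeas F) (hd : DependsUpTo k F) {n : ℕ}
    (hkn : k ≤ n) :
    ∫ ω, F ω ∂(pfLaw M0 M G Np n) = ∫ ω, F ω ∂(pfLaw M0 M G Np k) := by
  induction n, hkn using Nat.le_induction with
  | base => rfl
  | succ n hkn ih => rw [integral_pfLaw_succ_of_dependsUpTo hG hNp hF (hd.mono hkn), ih]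

lemma integral_mul_etaN_succ (hF : BddMeas F) (hd : DependsUpTo k F) (hφ : BddMeas φ) :
    ∫ ω, F ω * etaN Np (k + 1) φ ω ∂(pfLaw M0 M G Np (k + 1)) =
      ∫ ω, F ω * predictMean M G Np k φ ω ∂(pfLaw M0 M G Np k) := by
  rw [integral_pfLaw_succ hG hNp k (hF.mul (bddMeas_etaN hφ Np (k + 1))) fun ω ω' h =>
    congrArg₂ (· * ·) (hd.mono k.le_succ ω ω' h) (dependsUpTo_etaN Np _ φ ω ω' h)]
  refine integral_congr_ae (Eventually.of_forall fun ω => ?_)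
  have := isProbabilityMeasure_predict (M := M) hG hNp k (ω.1 k)
  simp only [hd.apply_update, etaN_update]
  rw [integral_const_mul, integral_mean_eval (hNp _) hφ, integral_predict hG hNp hφ]

lemma integral_mul_etaN_succ_sq (hF : BddMeas F) (hd : DependsUpTo k F) (hφ : BddMeas φ) :
    ∫ ω, F ω * etaN Np (k + 1) φ ω ^ 2 ∂(pfLaw M0 M G Np (k + 1)) =
      ∫ ω, F ω * (predictMean M G Np k φ ω ^ 2 + (Np (k + 1) : ℝ)⁻¹ *
        (predictMean M G Np k (fun x => φ x ^ 2) ω - predictMean M G Np k φ ω ^ 2))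
        ∂(pfLaw M0 M G Np k) := by
  rw [integral_pfLaw_succ hG hNp k (hF.mul ((bddMeas_etaN hφ Np (k + 1)).pow 2)) fun ω ω' h =>
    congrArg₂ (fun a b => a * b ^ 2) (hd.mono k.le_succ ω ω' h) (dependsUpTo_etaN Np _ φ ω ω' h)]
  refine integral_congr_ae (Eventually.of_forall fun ω => ?_)
  have := isProbabilityMeasure_predict (M := M) hG hNp k (ω.1 k)
  simp only [hd.apply_update, etaN_update]
  rw [integral_const_mul, integral_mean_eval_sq (hNp _) hφ, integral_predict hG hNp hφ,
    integral_predict hG hNp (hφ.pow 2)]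

lemma integral_etaN_succ_sub_pow_four_le (hφ : Measurable φ) {C : ℝ} (hC : ∀ x, |φ x| ≤ C) :
    ∫ ω, (etaN Np (k + 1) φ ω - predictMean M G Np k φ ω) ^ 4 ∂(pfLaw M0 M G Np (k + 1)) ≤
      48 * C ^ 4 / (Np (k + 1) : ℝ) ^ 2 := by
  have hφB : BddMeas φ := ⟨hφ, C, hC⟩
  have := isProbabilityMeasure_pfLaw (M0 := M0) (M := M) hG hNp k
  rw [integral_pfLaw_succ hG hNp k (((bddMeas_etaN hφB Np (k + 1)).sub
    (bddMeas_predictMean hG hNp hφB k)).pow 4) fun ω ω' h =>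
    congrArg₂ (fun a b => (a - b) ^ 4) (dependsUpTo_etaN Np _ φ ω ω' h)
      ((dependsUpTo_predictMean k).mono k.le_succ ω ω' h)]
  have h0 : (0 : ℝ) ≤ 48 * C ^ 4 / (Np (k + 1) : ℝ) ^ 2 := by positivity
  refine (integral_mono_of_nonneg (Eventually.of_forall fun ω => integral_nonneg fun x => by
    positivity) (integrable_const (48 * C ^ 4 / (Np (k + 1) : ℝ) ^ 2))
    (Eventually.of_forall fun ω => ?_)).trans (by simp)
  have := isProbabilityMeasure_predict (M := M) hG hNp k (ω.1 k)
  simp only [(dependsUpTo_predictMean k).apply_update, etaN_update]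
  rw [← integral_predict hG hNp hφB]
  exact integral_mean_eval_sub_pow_four_le (hNp _) hφ hC

end Moments

end ParticleSystem

section FeynmanKac

variable {M0 : Measure X} [IsProbabilityMeasure M0] {M : ℕ → Kernel X X}
  [∀ p, IsMarkovKernel (M p)] {G : ℕ → X → ℝ} {Np : ℕ → ℕ} {φ ψ : X → ℝ}

lemma measurable_ofReal_comp (hG : Admissible G) (p : ℕ) :
    Measurable fun x => ENNReal.ofReal (G p x) := (hG.bddMeas p).measurable.ennreal_ofReal

lemma isFiniteMeasure_withDensity_potential (hG : Admissible G) (p : ℕ) (μ : Measure X)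
    [IsFiniteMeasure μ] : IsFiniteMeasure (μ.withDensity fun x => ENNReal.ofReal (G p x)) :=
  isFiniteMeasure_withDensity_ofReal ((hG.bddMeas p).integrable μ).2

lemma isFiniteMeasure_gammaFK (hG : Admissible G) (p : ℕ) :
    IsFiniteMeasure (gammaFK M0 M G p) := by
  induction p with
  | zero => exact inferInstanceAs (IsFiniteMeasure M0)
  | succ p ih =>
    have := isFiniteMeasure_withDensity_potential hG p (gammaFK M0 M G p)
    exact inferInstanceAs (IsFiniteMeasure (M (p + 1) ∘ₘ
      ((gammaFK M0 M G p).withDensity fun x => ENNReal.ofReal (G p x))))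

lemma gInt_succ (hG : Admissible G) (hφ : BddMeas φ) (p : ℕ) :
    gInt M0 M G (p + 1) φ = gInt M0 M G p (fkStep M G p φ) := by
  have := isFiniteMeasure_gammaFK (M0 := M0) (M := M) hG p
  have := isFiniteMeasure_withDensity_potential hG p (gammaFK M0 M G p)
  rw [gInt, gammaFK, integral_bind_of_bddMeas (M (p + 1)).measurable hφ,
    integral_withDensity_eq_integral_toReal_smul (measurable_ofReal_comp hG p)
      (Eventually.of_forall fun _ => ENNReal.ofReal_lt_top)]
  simp only [ENNReal.toReal_ofReal (hG.pos p _).le, smul_eq_mul]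
  rfl

lemma gInt_add (hG : Admissible G) (hφ : BddMeas φ) (hψ : BddMeas ψ) (p : ℕ) :
    gInt M0 M G p (fun x => φ x + ψ x) = gInt M0 M G p φ + gInt M0 M G p ψ := by
  have := isFiniteMeasure_gammaFK (M0 := M0) (M := M) hG p
  exact integral_add (hφ.integrable _) (hψ.integrable _)

lemma gInt_sub_const (hG : Admissible G) (hφ : BddMeas φ) (a : ℝ) (p : ℕ) :
    gInt M0 M G p (fun x => φ x - a) = gInt M0 M G p φ - a * gInt M0 M G p 1 := by
  have := isFiniteMeasure_gammaFK (M0 := M0) (M := M) hG p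
  simp only [gInt]
  rw [integral_sub (hφ.integrable _) (integrable_const _)]
  simp [mul_comm]

lemma fkStep_one (M : ℕ → Kernel X X) [∀ p, IsMarkovKernel (M p)] (G : ℕ → X → ℝ) (p : ℕ) :
    fkStep M G p 1 = G p := by
  ext x
  simp [fkStep]

lemma bddMeas_one : BddMeas (1 : X → ℝ) := BddMeas.const 1

lemma gInt_succ_one (hG : Admissible G) (p : ℕ) :
    gInt M0 M G (p + 1) 1 = gInt M0 M G p (G p) := by
  rw [gInt_succ hG bddMeas_one, fkStep_one]

lemma gInt_one_pos (hG : Admissible G) (p : ℕ) : 0 < gInt M0 M G p 1 := by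
  induction p with
  | zero => simp [gInt, gammaFK]
  | succ p ih =>
    have := isFiniteMeasure_gammaFK (M0 := M0) (M := M) hG p
    rw [gInt_succ_one hG, gInt, integral_pos_iff_support_of_nonneg (fun x => (hG.pos p x).le)
      ((hG.bddMeas p).integrable _),
      Set.eq_univ_of_forall (s := Function.support (G p)) fun x => (hG.pos p x).ne',
      Measure.measure_univ_pos]
    intro h
    simp [gInt, h] at ih

lemma eInt_pos (hG : Admissible G) (p : ℕ) : 0 < eInt M0 M G p (G p) := by
  rw [eInt, ← gInt_succ_one hG]
  exact div_pos (gInt_one_pos hG _) (gInt_one_pos hG _)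

lemma prod_eInt_mul (hG : Admissible G) (n : ℕ) :
    (∏ p ∈ Finset.range n, eInt M0 M G p (G p)) = gInt M0 M G n 1 := by
  induction n with
  | zero => simp [gInt, gammaFK]
  | succ n ih =>
    rw [Finset.prod_range_succ, ih, eInt, mul_div_cancel₀ _ (gInt_one_pos hG n).ne',
      gInt_succ_one hG]

lemma gInt_eq_prod_mul_eInt (hG : Admissible G) (n : ℕ) (φ : X → ℝ) :
    gInt M0 M G n φ = (∏ p ∈ Finset.range n, eInt M0 M G p (G p)) * eInt M0 M G n φ := by
  rw [prod_eInt_mul hG, eInt, mul_div_cancel₀ _ (gInt_one_pos hG n).ne']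

lemma eInt_succ (hG : Admissible G) (hφ : BddMeas φ) (p : ℕ) :
    eInt M0 M G (p + 1) φ = eInt M0 M G p (fkStep M G p φ) / eInt M0 M G p (G p) := by
  rw [eInt, eInt, eInt, gInt_succ hG hφ, gInt_succ_one hG,
    div_div_div_cancel_right₀ (gInt_one_pos hG p).ne']

lemma bddMeas_gammaN (hG : Admissible G) (hφ : BddMeas φ) (n : ℕ) :
    BddMeas (gammaN G Np n φ) :=
  (BddMeas.prod _ fun p _ => bddMeas_etaN (hG.bddMeas p) Np p).mul (bddMeas_etaN hφ Np n)

omit [MeasurableSpace X] in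
lemma gammaN_add (n : ℕ) (φ ψ : X → ℝ) (ω : (ℕ → ℕ → X) × (ℕ → ℕ → ℕ)) :
    gammaN G Np n (fun x => φ x + ψ x) ω = gammaN G Np n φ ω + gammaN G Np n ψ ω := by
  simp only [gammaN, etaN, Finset.sum_add_distrib, mul_add]

omit [MeasurableSpace X] in
lemma etaN_sub_const {n : ℕ} (hn : 0 < Np n) (φ : X → ℝ) (a : ℝ)
    (ω : (ℕ → ℕ → X) × (ℕ → ℕ → ℕ)) :
    etaN Np n (fun x => φ x - a) ω = etaN Np n φ ω - a := by
  have h : (Np n : ℝ) ≠ 0 := Nat.cast_ne_zero.2 hn.ne'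
  simp only [etaN, Finset.sum_sub_distrib, Finset.sum_const, Finset.card_range, nsmul_eq_mul]
  field_simp

omit [MeasurableSpace X] in
lemma etaN_one {n : ℕ} (hn : 0 < Np n) (ω : (ℕ → ℕ → X) × (ℕ → ℕ → ℕ)) :
    etaN Np n 1 ω = 1 := by
  have h : (Np n : ℝ) ≠ 0 := Nat.cast_ne_zero.2 hn.ne'
  simp [etaN, h]

omit [MeasurableSpace X] in
lemma gammaN_eq_mul_etaN {n : ℕ} (hn : 0 < Np n) (φ : X → ℝ)
    (ω : (ℕ → ℕ → X) × (ℕ → ℕ → ℕ)) :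
    gammaN G Np n φ ω = gammaN G Np n 1 ω * etaN Np n φ ω := by
  simp [gammaN, etaN_one hn]

omit [∀ (p : ℕ), IsMarkovKernel (M p)] in
lemma gammaN_potential_mul_predictMean (hG : Admissible G) (hNp : ∀ p, 0 < Np p) (k : ℕ)
    (φ : X → ℝ) (ω : (ℕ → ℕ → X) × (ℕ → ℕ → ℕ)) :
    gammaN G Np k (G k) ω * predictMean M G Np k φ ω = gammaN G Np k (fkStep M G k φ) ω := by
  have h := (etaN_pos hG hNp k ω).ne'
  simp only [gammaN, predictMean]
  field_simp

omit [MeasurableSpace X] in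
lemma gammaN_succ (G : ℕ → X → ℝ) (Np : ℕ → ℕ) (k : ℕ) (φ : X → ℝ)
    (ω : (ℕ → ℕ → X) × (ℕ → ℕ → ℕ)) :
    gammaN G Np (k + 1) φ ω = gammaN G Np k (G k) ω * etaN Np (k + 1) φ ω := by
  simp only [gammaN, Finset.prod_range_succ]

omit [MeasurableSpace X] in
lemma dependsUpTo_gammaN (G : ℕ → X → ℝ) (Np : ℕ → ℕ) (n : ℕ) (φ : X → ℝ) :
    DependsUpTo n (gammaN G Np n φ) := fun ω ω' h => by
  simp only [gammaN]
  rw [dependsUpTo_etaN Np n φ ω ω' h, Finset.prod_congr rfl fun p hp =>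
    (dependsUpTo_etaN Np p (G p)).mono (Finset.mem_range.1 hp).le ω ω' h]

variable [Nonempty X]

omit [IsProbabilityMeasure M0] [∀ (p : ℕ), IsMarkovKernel (M p)] in
lemma integral_pfLaw_zero {f : (ℕ → ℕ → X) × (ℕ → ℕ → ℕ) → ℝ} (hf : BddMeas f) :
    ∫ ω, f ω ∂(pfLaw M0 M G Np 0) = ∫ x : Fin (Np 0) → X,
      f (fun p => if p = 0 then padF x else fun _ => Classical.arbitrary X, fun _ _ => 0)
        ∂(Measure.pi fun _ => M0) := by
  rw [pfLaw, integral_map measurable_init.aemeasurable hf.measurable.aestronglyMeasurable]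

omit [MeasurableSpace X] in
lemma etaN_init (x : Fin (Np 0) → X) (A : ℕ → ℕ → ℕ) (y : ℕ → ℕ → X) :
    etaN Np 0 φ (fun p => if p = 0 then padF x else y p, A) =
      (Np 0 : ℝ)⁻¹ * ∑ j, φ (x j) := by
  simp only [etaN, if_true]
  rw [Finset.sum_range]
  simp [padF]

section Moments

variable (hG : Admissible G) (hNp : ∀ p, 0 < Np p)

include hNp

omit [∀ (p : ℕ), IsMarkovKernel (M p)] in
lemma integral_etaN_zero (hφ : BddMeas φ) :
    ∫ ω, etaN Np 0 φ ω ∂(pfLaw M0 M G Np 0) = ∫ x, φ x ∂M0 := by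
  rw [integral_pfLaw_zero (bddMeas_etaN hφ Np 0)]
  simp only [etaN_init]
  exact integral_mean_eval (hNp 0) hφ

omit [∀ (p : ℕ), IsMarkovKernel (M p)] in
lemma integral_etaN_zero_sq (hφ : BddMeas φ) :
    ∫ ω, etaN Np 0 φ ω ^ 2 ∂(pfLaw M0 M G Np 0) =
      (∫ x, φ x ∂M0) ^ 2 + (Np 0 : ℝ)⁻¹ * (∫ x, φ x ^ 2 ∂M0 - (∫ x, φ x ∂M0) ^ 2) := by
  rw [integral_pfLaw_zero ((bddMeas_etaN hφ Np 0).pow 2)]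
  simp only [etaN_init]
  exact integral_mean_eval_sq (hNp 0) hφ

omit [∀ (p : ℕ), IsMarkovKernel (M p)] in
lemma integral_etaN_zero_sub_pow_four_le (hφ : Measurable φ) {C : ℝ} (hC : ∀ x, |φ x| ≤ C) :
    ∫ ω, (etaN Np 0 φ ω - ∫ x, φ x ∂M0) ^ 4 ∂(pfLaw M0 M G Np 0) ≤
      48 * C ^ 4 / (Np 0 : ℝ) ^ 2 := by
  rw [integral_pfLaw_zero (((bddMeas_etaN ⟨hφ, C, hC⟩ Np 0).sub (.const _)).pow 4)]
  simp only [etaN_init]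
  exact integral_mean_eval_sub_pow_four_le (hNp 0) hφ hC

include hG

lemma integral_gammaN (n : ℕ) (hφ : BddMeas φ) :
    ∫ ω, gammaN G Np n φ ω ∂(pfLaw M0 M G Np n) = gInt M0 M G n φ := by
  induction n generalizing φ with
  | zero => simpa [gammaN, gInt, gammaFK] using integral_etaN_zero hNp hφ
  | succ k ih =>
    simp only [gammaN_succ]
    rw [integral_mul_etaN_succ hG hNp (bddMeas_gammaN hG (hG.bddMeas k) k)
      (dependsUpTo_gammaN G Np k (G k)) hφ]
    simp only [gammaN_potential_mul_predictMean hG hNp]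
    rw [ih (bddMeas_fkStep hG hφ k), gInt_succ hG hφ]

lemma integral_gammaN_succ_sq (k : ℕ) (hφ : BddMeas φ) :
    ∫ ω, gammaN G Np (k + 1) φ ω ^ 2 ∂(pfLaw M0 M G Np (k + 1)) =
      ∫ ω, gammaN G Np k (fkStep M G k φ) ω ^ 2 ∂(pfLaw M0 M G Np k) +
        (Np (k + 1) : ℝ)⁻¹ *
          (∫ ω, gammaN G Np k (G k) ω * gammaN G Np k (fkStep M G k fun x => φ x ^ 2) ω
              ∂(pfLaw M0 M G Np k) -
            ∫ ω, gammaN G Np k (fkStep M G k φ) ω ^ 2 ∂(pfLaw M0 M G Np k)) := by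
  have := isProbabilityMeasure_pfLaw (M0 := M0) (M := M) hG hNp k
  have h1 := bddMeas_gammaN (Np := Np) hG (hG.bddMeas k) k
  have h2 := bddMeas_gammaN (Np := Np) hG (bddMeas_fkStep (M := M) hG hφ k) k
  have h3 := bddMeas_gammaN (Np := Np) hG (bddMeas_fkStep (M := M) hG (hφ.pow 2) k) k
  simp only [gammaN_succ, mul_pow]
  rw [integral_mul_etaN_succ_sq hG hNp (h1.pow 2)
    (fun ω ω' h => congrArg (· ^ 2) (dependsUpTo_gammaN G Np k (G k) ω ω' h)) hφ]
  rw [← integral_sub ((h1.mul h3).integrable _) ((h2.pow 2).integrable _), ← integral_const_mul,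
    ← integral_add ((h2.pow 2).integrable _)
      ((((h1.mul h3).sub (h2.pow 2)).const_mul _).integrable _)]
  refine integral_congr_ae (Eventually.of_forall fun ω => ?_)
  simp only [← gammaN_potential_mul_predictMean (M := M) hG hNp k]
  ring

end Moments

end FeynmanKac

lemma tendsto_of_tendsto_natCast_mul_sub {u : ℕ → ℝ} {a L : ℝ}
    (h : Tendsto (fun N : ℕ => (N : ℝ) * (u N - a)) atTop (nhds L)) :
    Tendsto u atTop (nhds a) := by
  have h1 := (tendsto_inv_atTop_nhds_zero_nat (𝕜 := ℝ)).mul h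
  rw [zero_mul] at h1
  have h2 := h1.const_add a
  rw [add_zero] at h2
  refine h2.congr' ?_
  filter_upwards [eventually_gt_atTop 0] with N hN
  have : (N : ℝ) ≠ 0 := Nat.cast_ne_zero.2 hN.ne'
  field_simp
  ring

lemma ae_tendsto_of_integral_pow_four_le {Ω : Type*} [MeasurableSpace Ω] {P : Measure Ω}
    {Y : ℕ → Ω → ℝ} {a K : ℝ} (hY : ∀ N, Measurable (Y N))
    (hi : ∀ N, 0 < N → Integrable (fun ω => (Y N ω - a) ^ 4) P)
    (hK : ∀ N : ℕ, 0 < N → ∫ ω, (Y N ω - a) ^ 4 ∂P ≤ K / (N : ℝ) ^ 2) :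
    ∀ᵐ ω ∂P, Tendsto (fun N => Y N ω) atTop (nhds a) := by
  have hs : Summable fun N : ℕ => K / ((N + 1 : ℕ) : ℝ) ^ 2 := by
    simp only [div_eq_mul_inv]
    exact ((summable_nat_add_iff 1).2 (Real.summable_nat_pow_inv.2 one_lt_two)).mul_left K
  have hm : ∀ N, Measurable fun ω => ENNReal.ofReal ((Y (N + 1) ω - a) ^ 4) := fun N =>
    (((hY _).sub_const a).pow_const 4).ennreal_ofReal
  have hle : ∫⁻ ω, ∑' N, ENNReal.ofReal ((Y (N + 1) ω - a) ^ 4) ∂P < ⊤ := by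
    rw [lintegral_tsum fun N => (hm N).aemeasurable]
    refine lt_of_le_of_lt (ENNReal.tsum_le_tsum fun N => ?_) hs.tsum_ofReal_lt_top
    rw [← ofReal_integral_eq_lintegral_ofReal (hi _ N.succ_pos)
      (Eventually.of_forall fun ω => by positivity)]
    exact ENNReal.ofReal_le_ofReal (hK _ N.succ_pos)
  filter_upwards [ae_lt_top (Measurable.tsum hm) hle.ne] with ω hω
  have h0 := ENNReal.tendsto_atTop_zero_of_tsum_ne_top hω.ne
  have h1 : Tendsto (fun N => (Y (N + 1) ω - a) ^ 4) atTop (nhds 0) := by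
    have := (ENNReal.tendsto_toReal ENNReal.zero_ne_top).comp h0
    refine this.congr fun N => ?_
    simp only [Function.comp]
    rw [ENNReal.toReal_ofReal (by positivity)]
  have h2 : Tendsto (fun N => Y (N + 1) ω - a) atTop (nhds 0) := by
    rw [tendsto_zero_iff_abs_tendsto_zero]
    have h3 := (h1.sqrt).sqrt
    rw [Real.sqrt_zero, Real.sqrt_zero] at h3
    refine h3.congr fun N => ?_
    rw [show (Y (N + 1) ω - a) ^ 4 = ((Y (N + 1) ω - a) ^ 2) ^ 2 by ring,
      Real.sqrt_sq (by positivity), Real.sqrt_sq_eq_abs]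
    rfl
  have h4 := h2.add_const a
  simp only [sub_add_cancel, zero_add] at h4
  exact (tendsto_add_atTop_iff_nat 1).1 h4

section Asymptotics

variable {M0 : Measure X} [IsProbabilityMeasure M0] {M : ℕ → Kernel X X}
  [∀ p, IsMarkovKernel (M p)] {G : ℕ → X → ℝ} {φ ψ : X → ℝ} {c : ℕ → ℝ}

lemma npart_pos (hc : ∀ p, 0 < c p) {N : ℕ} (hN : 0 < N) (p : ℕ) : 0 < npart c N p :=
  Nat.ceil_pos.2 (mul_pos (hc p) (Nat.cast_pos.2 hN))

lemma tendsto_mul_inv_npart (hc : ∀ p, 0 < c p) (p : ℕ) :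
    Tendsto (fun N : ℕ => (N : ℝ) * (npart c N p : ℝ)⁻¹) atTop (nhds (c p)⁻¹) := by
  have h := ((tendsto_nat_ceil_mul_div_atTop (hc p).le).comp
    (tendsto_natCast_atTop_atTop (R := ℝ))).inv₀ (hc p).ne'
  refine h.congr fun N => ?_
  simp [npart, div_eq_mul_inv]

lemma div_npart_sq_le (hc : ∀ p, 0 < c p) {a : ℝ} (ha : 0 ≤ a) {N : ℕ} (hN : 0 < N) (p : ℕ) :
    a / (npart c N p : ℝ) ^ 2 ≤ a / c p ^ 2 / (N : ℝ) ^ 2 := by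
  have h1 : 0 < c p * N := mul_pos (hc p) (Nat.cast_pos.2 hN)
  rw [div_div, ← mul_pow]
  exact div_le_div_of_nonneg_left ha (by positivity)
    (pow_le_pow_left₀ h1.le (Nat.le_ceil _) 2)

variable [Nonempty X] (hG : Admissible G) (hc : ∀ p, 0 < c p)

include hG hc

lemma tendsto_integral_gammaN_mul {k : ℕ}
    (h : ∀ φ : X → ℝ, BddMeas φ → Tendsto (fun N : ℕ =>
      ∫ ω, gammaN G (npart c N) k φ ω ^ 2 ∂(pfLaw M0 M G (npart c N) k)) atTop
        (nhds (gInt M0 M G k φ ^ 2))) (hφ : BddMeas φ) (hψ : BddMeas ψ) :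
    Tendsto (fun N : ℕ => ∫ ω, gammaN G (npart c N) k φ ω * gammaN G (npart c N) k ψ ω
      ∂(pfLaw M0 M G (npart c N) k)) atTop (nhds (gInt M0 M G k φ * gInt M0 M G k ψ)) := by
  have h1 := (((h _ (hφ.add hψ)).sub (h φ hφ)).sub (h ψ hψ)).div_const 2
  rw [gInt_add hG hφ hψ] at h1
  rw [show gInt M0 M G k φ * gInt M0 M G k ψ = ((gInt M0 M G k φ + gInt M0 M G k ψ) ^ 2 -
    gInt M0 M G k φ ^ 2 - gInt M0 M G k ψ ^ 2) / 2 by ring]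
  refine h1.congr' ?_
  filter_upwards [eventually_gt_atTop 0] with N hN
  have := isProbabilityMeasure_pfLaw (M0 := M0) (M := M) hG (npart_pos hc hN) k
  have b1 := bddMeas_gammaN (Np := npart c N) hG hφ k
  have b2 := bddMeas_gammaN (Np := npart c N) hG hψ k
  simp only [gammaN_add]
  rw [← integral_sub (((b1.add b2).pow 2).integrable _) ((b1.pow 2).integrable _),
    ← integral_sub ((((b1.add b2).pow 2).sub (b1.pow 2)).integrable _) ((b2.pow 2).integrable _),
    ← integral_div]
  refine integral_congr_ae (Eventually.of_forall fun ω => ?_)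
  ring

lemma exists_tendsto_mul_integral_gammaN_sq_sub (k : ℕ) (hφ : BddMeas φ) :
    ∃ L, Tendsto (fun N : ℕ => (N : ℝ) *
      (∫ ω, gammaN G (npart c N) k φ ω ^ 2 ∂(pfLaw M0 M G (npart c N) k) -
        gInt M0 M G k φ ^ 2)) atTop (nhds L) := by
  induction k generalizing φ with
  | zero =>
    refine ⟨_, ((tendsto_mul_inv_npart hc 0).mul_const
      (∫ x, φ x ^ 2 ∂M0 - (∫ x, φ x ∂M0) ^ 2)).congr' ?_⟩
    filter_upwards [eventually_gt_atTop 0] with N hN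
    simp only [gammaN, Finset.range_zero, Finset.prod_empty, one_mul]
    rw [integral_etaN_zero_sq (npart_pos hc hN) hφ, gInt, gammaFK]
    ring
  | succ k ih =>
    have hsq : ∀ ψ : X → ℝ, BddMeas ψ → Tendsto (fun N : ℕ =>
        ∫ ω, gammaN G (npart c N) k ψ ω ^ 2 ∂(pfLaw M0 M G (npart c N) k)) atTop
          (nhds (gInt M0 M G k ψ ^ 2)) := fun ψ hψ => by
      obtain ⟨L, hL⟩ := ih hψ
      exact tendsto_of_tendsto_natCast_mul_sub hL
    have hQ := bddMeas_fkStep (M := M) hG hφ k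
    obtain ⟨L, hL⟩ := ih hQ
    refine ⟨_, (hL.add ((tendsto_mul_inv_npart hc (k + 1)).mul
      ((tendsto_integral_gammaN_mul hG hc hsq (hG.bddMeas k)
        (bddMeas_fkStep (M := M) hG (hφ.pow 2) k)).sub (hsq _ hQ)))).congr' ?_⟩
    filter_upwards [eventually_gt_atTop 0] with N hN
    rw [integral_gammaN_succ_sq hG (npart_pos hc hN) k hφ, gInt_succ hG hφ]
    ring

lemma exists_integral_etaN_sub_pow_four_le (k : ℕ) (hφ : BddMeas φ) :
    ∃ K, ∀ N : ℕ, 0 < N →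
      ∫ ω, (etaN (npart c N) k φ ω - eInt M0 M G k φ) ^ 4 ∂(pfLaw M0 M G (npart c N) k) ≤
        K / (N : ℝ) ^ 2 := by
  induction k generalizing φ with
  | zero =>
    obtain ⟨C, hC⟩ := hφ.bounded
    refine ⟨48 * C ^ 4 / c 0 ^ 2, fun N hN => ?_⟩
    have he : eInt M0 M G 0 φ = ∫ x, φ x ∂M0 := by simp [eInt, gInt, gammaFK]
    rw [he]
    exact (integral_etaN_zero_sub_pow_four_le (npart_pos hc hN) hφ.measurable hC).trans
      (div_npart_sq_le hc (by positivity) hN 0)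
  | succ k ih =>
    obtain ⟨C, hC⟩ := hφ.bounded
    obtain ⟨K, hK⟩ := ih (bddMeas_fkStep (M := M) hG hφ k)
    obtain ⟨K', hK'⟩ := ih (hG.bddMeas k)
    have hDpos := eInt_pos (M0 := M0) (M := M) hG k
    set D := eInt M0 M G k (G k) with hD
    refine ⟨8 * (48 * C ^ 4 / c (k + 1) ^ 2) + 64 / D ^ 4 * (K + C ^ 4 * K'), fun N hN => ?_⟩
    have hNp := npart_pos hc hN
    have h4 : ∀ x y : ℝ, (x + y) ^ 4 ≤ 8 * (x ^ 4 + y ^ 4) := fun x y => by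
      nlinarith [sq_nonneg (x - y), sq_nonneg (x + y), sq_nonneg (x ^ 2 - y ^ 2),
        mul_nonneg (sq_nonneg (x - y)) (sq_nonneg (x + y)), sq_nonneg (x * y),
        mul_nonneg (sq_nonneg (x - y)) (sq_nonneg (x - y))]
    have := isProbabilityMeasure_pfLaw (M0 := M0) (M := M) hG hNp k
    have := isProbabilityMeasure_pfLaw (M0 := M0) (M := M) hG hNp (k + 1)
    have bη := bddMeas_etaN hφ (npart c N) (k + 1)
    have bΦ := bddMeas_predictMean (M := M) hG hNp hφ k
    have bA := bddMeas_etaN (bddMeas_fkStep (M := M) hG hφ k) (npart c N) k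
    have bB := bddMeas_etaN (hG.bddMeas k) (npart c N) k
    have hΦ : ∫ ω, (predictMean M G (npart c N) k φ ω - eInt M0 M G (k + 1) φ) ^ 4
        ∂(pfLaw M0 M G (npart c N) k) ≤ 8 / D ^ 4 * (K + C ^ 4 * K') / (N : ℝ) ^ 2 := by
      calc _ ≤ ∫ ω, 8 / D ^ 4 *
            ((etaN (npart c N) k (fkStep M G k φ) ω - eInt M0 M G k (fkStep M G k φ)) ^ 4 +
              C ^ 4 * (etaN (npart c N) k (G k) ω - D) ^ 4) ∂(pfLaw M0 M G (npart c N) k) := by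
            refine integral_mono (((bΦ.sub (.const _)).pow 4).integrable _)
              (((((bA.sub (.const _)).pow 4).add
                (((bB.sub (.const _)).pow 4).const_mul _)).const_mul _).integrable _) fun ω => ?_
            have hpos := etaN_pos hG hNp k ω
            have hb := abs_predictMean_le (M := M) hG hNp hφ.measurable hC k ω
            have heq : predictMean M G (npart c N) k φ ω - eInt M0 M G (k + 1) φ =
                (etaN (npart c N) k (fkStep M G k φ) ω - eInt M0 M G k (fkStep M G k φ)) / D +
                  predictMean M G (npart c N) k φ ω * (D - etaN (npart c N) k (G k) ω) / D := by
              rw [eInt_succ hG hφ, predictMean, ← hD]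
              field_simp
              ring
            have hp : predictMean M G (npart c N) k φ ω ^ 4 ≤ C ^ 4 := by
              rw [← Even.pow_abs (by decide : Even 4)]
              exact pow_le_pow_left₀ (abs_nonneg _) hb 4
            dsimp only
            rw [heq]
            refine (h4 _ _).trans ?_
            rw [div_pow, div_pow, mul_pow, ← add_div, mul_div_assoc', div_mul_eq_mul_div]
            refine div_le_div_of_nonneg_right ?_ (by positivity)
            rw [show (D - etaN (npart c N) k (G k) ω) ^ 4 =
              (etaN (npart c N) k (G k) ω - D) ^ 4 by ring]
            gcongr
        _ ≤ _ := by
            rw [integral_const_mul, integral_add (((bA.sub (.const _)).pow 4).integrable _)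
              ((((bB.sub (.const _)).pow 4).const_mul _).integrable _), integral_const_mul,
              mul_div_assoc, add_div, mul_div_assoc]
            gcongr
            · exact hK N hN
            · exact hK' N hN
    calc _ ≤ ∫ ω, 8 * ((etaN (npart c N) (k + 1) φ ω - predictMean M G (npart c N) k φ ω) ^ 4 +
          (predictMean M G (npart c N) k φ ω - eInt M0 M G (k + 1) φ) ^ 4)
            ∂(pfLaw M0 M G (npart c N) (k + 1)) := by
          refine integral_mono (((bη.sub (.const _)).pow 4).integrable _)
            ((((bη.sub bΦ).pow 4).add ((bΦ.sub (.const _)).pow 4)).const_mul _ |>.integrable _)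
            fun ω => ?_
          refine le_trans (le_of_eq ?_) (h4 _ _)
          ring
      _ ≤ 8 * (48 * C ^ 4 / c (k + 1) ^ 2 / (N : ℝ) ^ 2 +
          8 / D ^ 4 * (K + C ^ 4 * K') / (N : ℝ) ^ 2) := by
          rw [integral_const_mul, integral_add (((bη.sub bΦ).pow 4).integrable _)
            (((bΦ.sub (.const _)).pow 4).integrable _)]
          gcongr
          · exact (integral_etaN_succ_sub_pow_four_le hG hNp hφ.measurable hC).trans
              (div_npart_sq_le hc (by positivity) hN (k + 1))
          · rw [integral_pfLaw_succ_of_dependsUpTo hG hNp ((bΦ.sub (.const _)).pow 4)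
              fun ω ω' h => congrArg (fun a => (a - eInt M0 M G (k + 1) φ) ^ 4)
                (dependsUpTo_predictMean k ω ω' h)]
            exact hΦ
      _ = _ := by ring

end Asymptotics

section Limits

variable {M0 : Measure X} [IsProbabilityMeasure M0] {M : ℕ → Kernel X X}
  [∀ p, IsMarkovKernel (M p)] {G : ℕ → X → ℝ} {Np : ℕ → ℕ} {φ : X → ℝ} {c : ℕ → ℝ}
  [Nonempty X] {n : ℕ}

lemma variance_gammaN_div (hG : Admissible G) (hNp : ∀ p, 0 < Np p) (hφ : BddMeas φ) (g : ℝ) :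
    variance (fun ω => gammaN G Np n φ ω / g) (pfLaw M0 M G Np n) =
      (∫ ω, gammaN G Np n φ ω ^ 2 ∂(pfLaw M0 M G Np n) - gInt M0 M G n φ ^ 2) / g ^ 2 := by
  have := isProbabilityMeasure_pfLaw (M0 := M0) (M := M) hG hNp n
  have b := bddMeas_gammaN (Np := Np) hG hφ n
  have hm : MemLp (fun ω => gammaN G Np n φ ω / g) 2 (pfLaw M0 M G Np n) := by
    rw [memLp_two_iff_integrable_sq (b.div_const g).measurable.aestronglyMeasurable]
    exact ((b.div_const g).pow 2).integrable _
  rw [variance_eq_sub hm]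
  simp only [Pi.pow_apply, div_pow]
  rw [integral_div, integral_div, integral_gammaN hG hNp n hφ]
  ring

lemma exists_tendsto_mul_variance (hG : Admissible G) (hc : ∀ p, 0 < c p) (hφ : BddMeas φ) :
    ∃ L, Tendsto (fun N : ℕ => (N : ℝ) *
      variance (fun ω => gammaN G (npart c N) n φ ω / gInt M0 M G n 1)
        (pfLaw M0 M G (npart c N) n)) atTop (nhds L) := by
  obtain ⟨L, hL⟩ := exists_tendsto_mul_integral_gammaN_sq_sub (M0 := M0) (M := M) hG hc n hφ
  refine ⟨_, (hL.div_const (gInt M0 M G n 1 ^ 2)).congr' ?_⟩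
  filter_upwards [eventually_gt_atTop 0] with N hN
  rw [variance_gammaN_div hG (npart_pos hc hN) hφ, mul_div_assoc]

lemma exists_abs_gammaN_le (hG : Admissible G) (hφ : BddMeas φ) (n : ℕ) :
    ∃ C, ∀ Np : ℕ → ℕ, (∀ p, 0 < Np p) → ∀ ω, |gammaN G Np n φ ω| ≤ C := by
  choose B hB using fun p => (hG.bddMeas p).bounded
  obtain ⟨C, hC⟩ := hφ.bounded
  refine ⟨(∏ p ∈ Finset.range n, B p) * C, fun Np hNp ω => ?_⟩
  rw [gammaN, abs_mul, Finset.abs_prod]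
  refine mul_le_mul ?_ (abs_etaN_le hNp hC n ω) (abs_nonneg _)
    (Finset.prod_nonneg fun p _ => (abs_nonneg _).trans (hB p (Classical.arbitrary X)))
  exact Finset.prod_le_prod (fun _ _ => abs_nonneg _) fun p _ => abs_etaN_le hNp (hB p) p ω

/-- The rescaled mean square error of `η_n^N(φ)` has the limit of the rescaled variance of
`γ_n^N(φ - η_n(φ)) / γ_n(1)`. -/
lemma tendsto_mul_integral_etaN_sub_sq (hG : Admissible G) (hc : ∀ p, 0 < c p)
    (hφ : BddMeas φ) {L : ℝ}
    (hL : Tendsto (fun N : ℕ => (N : ℝ) *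
      variance (fun ω => gammaN G (npart c N) n (fun x => φ x - eInt M0 M G n φ) ω /
        gInt M0 M G n 1) (pfLaw M0 M G (npart c N) n)) atTop (nhds L)) :
    Tendsto (fun N : ℕ => (N : ℝ) *
      ∫ ω, (etaN (npart c N) n φ ω - eInt M0 M G n φ) ^ 2 ∂(pfLaw M0 M G (npart c N) n))
        atTop (nhds L) := by
  have hg := gInt_one_pos (M0 := M0) (M := M) hG n
  set g := gInt M0 M G n 1 with hgdef
  set e := eInt M0 M G n φ with he
  obtain ⟨K, hK⟩ := exists_integral_etaN_sub_pow_four_le (M0 := M0) (M := M) hG hc n hφ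
  obtain ⟨B, hB⟩ := exists_abs_gammaN_le hG (bddMeas_one (X := X)) n
  obtain ⟨V, hV⟩ := exists_tendsto_mul_variance (M0 := M0) (M := M) (n := n) hG hc
    (bddMeas_one (X := X))
  set R := (1 + B / g) ^ 2 * (|V| + 1) with hR
  have hsmall : Tendsto (fun N : ℕ => (K + R) / 2 * (√(N : ℝ))⁻¹) atTop (nhds 0) := by
    simpa using ((Real.tendsto_sqrt_atTop.comp
      (tendsto_natCast_atTop_atTop (R := ℝ))).inv_tendsto_atTop).const_mul ((K + R) / 2)
  have hdiff : Tendsto (fun N : ℕ => (N : ℝ) *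
      ∫ ω, (etaN (npart c N) n φ ω - e) ^ 2 ∂(pfLaw M0 M G (npart c N) n) - (N : ℝ) *
      variance (fun ω => gammaN G (npart c N) n (fun x => φ x - e) ω / g)
        (pfLaw M0 M G (npart c N) n)) atTop (nhds 0) := by
    refine squeeze_zero_norm' ?_ hsmall
    filter_upwards [eventually_gt_atTop 0,
      hV.eventually (gt_mem_nhds (lt_of_le_of_lt (le_abs_self V) (lt_add_one _)))] with N hN hVN
    have hNp := npart_pos hc hN
    have hN' : (0 : ℝ) < N := Nat.cast_pos.2 hN
    have := isProbabilityMeasure_pfLaw (M0 := M0) (M := M) hG hNp n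
    have bη : BddMeas fun ω => etaN (npart c N) n φ ω - e :=
      (bddMeas_etaN hφ (npart c N) n).sub (.const _)
    have br : BddMeas fun ω => gammaN G (npart c N) n 1 ω / g :=
      (bddMeas_gammaN hG (bddMeas_one (X := X)) n).div_const g
    have bd : BddMeas fun ω => 1 - (gammaN G (npart c N) n 1 ω / g) ^ 2 :=
      (BddMeas.const 1).sub (br.pow 2)
    have hzero : gInt M0 M G n (fun x => φ x - e) = 0 := by
      rw [gInt_sub_const hG hφ, he, eInt, div_mul_cancel₀ _ hg.ne', sub_self]
    have hvar : variance (fun ω => gammaN G (npart c N) n (fun x => φ x - e) ω / g)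
        (pfLaw M0 M G (npart c N) n) =
        ∫ ω, (gammaN G (npart c N) n 1 ω / g) ^ 2 * (etaN (npart c N) n φ ω - e) ^ 2
          ∂(pfLaw M0 M G (npart c N) n) := by
      rw [variance_gammaN_div hG hNp (hφ.sub (.const e)), hzero, zero_pow two_ne_zero, sub_zero,
        ← integral_div]
      refine integral_congr_ae (Eventually.of_forall fun ω => ?_)
      dsimp only
      rw [gammaN_eq_mul_etaN (hNp n), etaN_sub_const (hNp n)]
      ring
    have hd2 : ∫ ω, (1 - (gammaN G (npart c N) n 1 ω / g) ^ 2) ^ 2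
        ∂(pfLaw M0 M G (npart c N) n) ≤ R / N := by
      have hvr : ∫ ω, (1 - gammaN G (npart c N) n 1 ω / g) ^ 2
          ∂(pfLaw M0 M G (npart c N) n) = variance (fun ω => gammaN G (npart c N) n 1 ω / g)
            (pfLaw M0 M G (npart c N) n) := by
        rw [variance_eq_integral br.measurable.aemeasurable, integral_div,
          integral_gammaN hG hNp n bddMeas_one, div_self hg.ne']
        refine integral_congr_ae (Eventually.of_forall fun ω => ?_)
        ring
      calc _ ≤ ∫ ω, (1 + B / g) ^ 2 * (1 - gammaN G (npart c N) n 1 ω / g) ^ 2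
            ∂(pfLaw M0 M G (npart c N) n) := by
            refine integral_mono ((bd.pow 2).integrable _)
              (((((BddMeas.const 1).sub br).pow 2).const_mul _).integrable _) fun ω => ?_
            dsimp only
            rw [show 1 - (gammaN G (npart c N) n 1 ω / g) ^ 2 =
              (1 + gammaN G (npart c N) n 1 ω / g) * (1 - gammaN G (npart c N) n 1 ω / g) by ring,
              mul_pow]
            refine mul_le_mul_of_nonneg_right ?_ (sq_nonneg _)
            refine sq_le_sq' ?_ ?_
            · have := neg_le_of_abs_le (hB _ hNp ω)
              have := div_le_div_of_nonneg_right this hg.le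
              rw [neg_div] at this
              linarith
            · have := div_le_div_of_nonneg_right (le_of_abs_le (hB _ hNp ω)) hg.le
              linarith
        _ ≤ R / N := by
            rw [integral_const_mul, hvr, hR, mul_div_assoc]
            refine mul_le_mul_of_nonneg_left ?_ (sq_nonneg _)
            rw [le_div_iff₀ hN', mul_comm]
            exact hVN.le
    have hs : 0 < √(N : ℝ) := Real.sqrt_pos.2 hN'
    have hss : √(N : ℝ) ^ 2 = N := Real.sq_sqrt hN'.le
    rw [hvar, ← mul_sub, ← integral_sub ((bη.pow 2).integrable _)
      (((br.pow 2).mul (bη.pow 2)).integrable _), ← integral_const_mul]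
    calc _ ≤ ∫ ω, (((√(N : ℝ))⁻¹ * (N : ℝ) ^ 2 / 2) * (etaN (npart c N) n φ ω - e) ^ 4 +
          (√(N : ℝ) / 2) * (1 - (gammaN G (npart c N) n 1 ω / g) ^ 2) ^ 2)
            ∂(pfLaw M0 M G (npart c N) n) := by
          refine norm_integral_le_of_norm_le
            ((((bη.pow 4).const_mul _).add ((bd.pow 2).const_mul _)).integrable _)
            (Eventually.of_forall fun ω => ?_)
          generalize etaN (npart c N) n φ ω - e = h
          generalize gammaN G (npart c N) n 1 ω / g = r
          rw [show (N : ℝ) * (h ^ 2 - r ^ 2 * h ^ 2) = (N * h ^ 2) * (1 - r ^ 2) by ring,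
            Real.norm_eq_abs, abs_mul, abs_of_nonneg (by positivity)]
          have hsq := sq_nonneg ((N : ℝ) * h ^ 2 - √(N : ℝ) * |1 - r ^ 2|)
          rw [← sq_abs (1 - r ^ 2)]
          generalize |1 - r ^ 2| = d at hsq ⊢
          rw [show (√(N : ℝ))⁻¹ * (N : ℝ) ^ 2 / 2 * h ^ 4 + √(N : ℝ) / 2 * d ^ 2 =
            ((N : ℝ) * h ^ 2 * ((N : ℝ) * h ^ 2) + √(N : ℝ) ^ 2 * d ^ 2) / (2 * √(N : ℝ)) by
              field_simp, le_div_iff₀ (by positivity)]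
          nlinarith [hsq]
      _ ≤ (√(N : ℝ))⁻¹ * (N : ℝ) ^ 2 / 2 * (K / (N : ℝ) ^ 2) + √(N : ℝ) / 2 * (R / N) := by
          rw [integral_add (((bη.pow 4).const_mul _).integrable _)
            (((bd.pow 2).const_mul _).integrable _), integral_const_mul, integral_const_mul]
          gcongr
          exact hK N hN
      _ = (K + R) / 2 * (√(N : ℝ))⁻¹ := by
          rw [show R / (N : ℝ) = R / √(N : ℝ) ^ 2 by rw [hss]]
          field_simp
  simpa using hdiff.add hL

section AlmostSure

variable {P : Measure (ℕ → (ℕ → ℕ → X) × (ℕ → ℕ → ℕ))} [IsProbabilityMeasure P]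
  (hP : ∀ N : ℕ, P.map (fun ω => ω N) = pfLaw M0 M G (npart c N) n)

include hP

lemma ae_tendsto_etaN (hG : Admissible G) (hc : ∀ p, 0 < c p) {k : ℕ} (hk : k ≤ n)
    (hφ : BddMeas φ) :
    ∀ᵐ ω ∂P, Tendsto (fun N => etaN (npart c N) k φ (ω N)) atTop
      (nhds (eInt M0 M G k φ)) := by
  obtain ⟨K, hK⟩ := exists_integral_etaN_sub_pow_four_le (M0 := M0) (M := M) hG hc k hφ
  have b : ∀ N, BddMeas fun ω : (ℕ → ℕ → X) × (ℕ → ℕ → ℕ) =>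
      (etaN (npart c N) k φ ω - eInt M0 M G k φ) ^ 4 := fun N =>
    ((bddMeas_etaN hφ (npart c N) k).sub (.const _)).pow 4
  refine ae_tendsto_of_integral_pow_four_le (K := K)
    (fun N => (bddMeas_etaN hφ (npart c N) k).measurable.comp (measurable_pi_apply N))
    (fun N _ => ((b N).comp (measurable_pi_apply N)).integrable _) fun N hN => ?_
  have := integral_map (μ := P) (measurable_pi_apply N).aemeasurable
    (b N).measurable.aestronglyMeasurable
  rw [hP] at this
  rw [← this, integral_pfLaw_of_dependsUpTo hG (npart_pos hc hN) (b N)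
    (fun ω ω' h => congrArg (fun a => (a - eInt M0 M G k φ) ^ 4)
      (dependsUpTo_etaN (npart c N) k φ ω ω' h)) hk]
  exact hK N hN

lemma ae_tendsto_gammaN (hG : Admissible G) (hc : ∀ p, 0 < c p) (hφ : BddMeas φ) :
    ∀ᵐ ω ∂P, Tendsto (fun N => gammaN G (npart c N) n φ (ω N)) atTop
      (nhds (gInt M0 M G n φ)) := by
  have h : ∀ᵐ ω ∂P, ∀ p, p ≤ n → Tendsto (fun N => etaN (npart c N) p (G p) (ω N)) atTop
      (nhds (eInt M0 M G p (G p))) := by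
    refine ae_all_iff.2 fun p => ?_
    by_cases hp : p ≤ n
    · filter_upwards [ae_tendsto_etaN hP hG hc hp (hG.bddMeas p)] with ω hω _ using hω
    · exact Eventually.of_forall fun ω h => absurd h hp
  filter_upwards [h, ae_tendsto_etaN hP hG hc le_rfl hφ] with ω h1 h2
  rw [gInt_eq_prod_mul_eInt hG]
  exact (tendsto_finsetProd _ fun p hp => h1 p (Finset.mem_range.1 hp).le).mul h2

end AlmostSure

end Limits

section Congruence

variable {M0 : Measure X} {M : ℕ → Kernel X X} {G G' : ℕ → X → ℝ} {Np Np' : ℕ → ℕ} {n : ℕ}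

lemma gammaFK_congr (hG : ∀ p < n, G p = G' p) : gammaFK M0 M G n = gammaFK M0 M G' n := by
  induction n with
  | zero => rfl
  | succ n ih => rw [gammaFK, gammaFK, ih fun p hp => hG p (by omega), hG n n.lt_succ_self]

lemma pfLaw_congr [Nonempty X] (hG : ∀ p < n, G p = G' p) (hNp : ∀ p ≤ n, Np p = Np' p) :
    pfLaw M0 M G Np n = pfLaw M0 M G' Np' n := by
  induction n with
  | zero => rw [pfLaw, pfLaw, hNp 0 le_rfl]
  | succ n ih =>
    have : pfStep M G Np n = pfStep M G' Np' n := by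
      ext1 z
      rw [pfStep, pfStep, hNp _ le_rfl, hNp n n.le_succ, hG n n.lt_succ_self]
    rw [pfLaw, pfLaw, ih (fun p hp => hG p (by omega)) fun p hp => hNp p (by omega), this]

omit [MeasurableSpace X] in
lemma etaN_congr (hNp : Np n = Np' n) (φ : X → ℝ) : etaN Np n φ = etaN Np' n φ := by
  ext ω
  rw [etaN, etaN, hNp]

omit [MeasurableSpace X] in
lemma gammaN_congr (hG : ∀ p < n, G p = G' p) (hNp : ∀ p ≤ n, Np p = Np' p) (φ : X → ℝ) :
    gammaN G Np n φ = gammaN G' Np' n φ := by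
  ext ω
  rw [gammaN, gammaN, etaN_congr (hNp n le_rfl)]
  congr 1
  refine Finset.prod_congr rfl fun p hp => ?_
  have hp' := Finset.mem_range.1 hp
  rw [etaN_congr (hNp p hp'.le), hG p hp']

end Congruence

open PFVar MeasureTheory ProbabilityTheory Filter

theorem statement1
    {X : Type*} [MeasurableSpace X] [Nonempty X] (hX : ∃ x y : X, x ≠ y) (n : ℕ)
    (M0 : Measure X) [IsProbabilityMeasure M0]
    (M : ℕ → Kernel X X) [∀ p, IsMarkovKernel (M p)]
    (G : ℕ → X → ℝ) (hGm : ∀ p ≤ n, Measurable (G p))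
    (hGpos : ∀ p ≤ n, ∀ x, 0 < G p x) (hGbd : ∀ p ≤ n, ∃ C, ∀ x, G p x ≤ C)
    (c : ℕ → ℝ) (hc : ∀ p ≤ n, 0 < c p) :
    ∃ σ2 : (X → ℝ) → ℝ,
      (∀ φ : X → ℝ, Measurable φ → (∃ C, ∀ x, |φ x| ≤ C) → 0 ≤ σ2 φ) ∧
      ∀ φ : X → ℝ, Measurable φ → (∃ C, ∀ x, |φ x| ≤ C) →
        (∀ N : ℕ, 1 ≤ N → (∀ p ≤ n, 2 ≤ npart c N p) →
          ∫ ω, gammaN G (npart c N) n φ ω ∂(pfLaw M0 M G (npart c N) n)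
            = gInt M0 M G n φ) ∧
        (∀ P : Measure (ℕ → (ℕ → ℕ → X) × (ℕ → ℕ → ℕ)), IsProbabilityMeasure P →
          (∀ N : ℕ, P.map (fun ω => ω N) = pfLaw M0 M G (npart c N) n) →
          (∀ᵐ ω ∂P, Tendsto (fun N => gammaN G (npart c N) n φ (ω N)) atTop
              (nhds (gInt M0 M G n φ))) ∧
          (∀ᵐ ω ∂P, Tendsto (fun N => etaN (npart c N) n φ (ω N)) atTop
              (nhds (eInt M0 M G n φ)))) ∧
        Tendsto (fun N : ℕ => (N : ℝ) *
            variance (fun ω => gammaN G (npart c N) n φ ω / gInt M0 M G n 1)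
              (pfLaw M0 M G (npart c N) n)) atTop (nhds (σ2 φ)) ∧
        Tendsto (fun N : ℕ => (N : ℝ) *
            ∫ ω, (etaN (npart c N) n φ ω - eInt M0 M G n φ) ^ 2
              ∂(pfLaw M0 M G (npart c N) n))
          atTop (nhds (σ2 fun x => φ x - eInt M0 M G n φ)) := by
  let G' : ℕ → X → ℝ := fun p => if p ≤ n then G p else 1
  let c' : ℕ → ℝ := fun p => if p ≤ n then c p else 1
  have hG' : Admissible G' := by
    refine ⟨fun p => ?_, fun p x => ?_⟩ <;> by_cases hp : p ≤ n
    · obtain ⟨C, hC⟩ := hGbd p hp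
      have hb : ∀ x, |G p x| ≤ C := fun x => (abs_of_pos (hGpos p hp x)).trans_le (hC x)
      simpa only [G', if_pos hp] using BddMeas.mk (hGm p hp) ⟨C, hb⟩
    · simpa only [G', if_neg hp] using bddMeas_one
    · simpa only [G', if_pos hp] using hGpos p hp x
    · simp [G', if_neg hp]
  have hc' : ∀ p, 0 < c' p := fun p => by
    by_cases hp : p ≤ n
    · simpa only [c', if_pos hp] using hc p hp
    · simp [c', if_neg hp]
  have hGG : ∀ p < n, G p = G' p := fun p hp => (if_pos hp.le).symm
  have hcc : ∀ N, ∀ p ≤ n, npart c N p = npart c' N p := fun N p hp => by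
    simp only [npart, c', if_pos hp]
  have hlaw : ∀ N, pfLaw M0 M G (npart c N) n = pfLaw M0 M G' (npart c' N) n :=
    fun N => pfLaw_congr hGG (hcc N)
  have hγ : ∀ N φ, gammaN G (npart c N) n φ = gammaN G' (npart c' N) n φ :=
    fun N => gammaN_congr hGG (hcc N)
  have hη : ∀ N (φ : X → ℝ), etaN (npart c N) n φ = etaN (npart c' N) n φ :=
    fun N => etaN_congr (hcc N n le_rfl)
  have hgI : ∀ φ, gInt M0 M G n φ = gInt M0 M G' n φ := fun φ => by
    rw [gInt, gInt, gammaFK_congr hGG]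
  have heI : ∀ φ, eInt M0 M G n φ = eInt M0 M G' n φ := fun φ => by
    rw [eInt, eInt, hgI, hgI]
  simp only [hlaw, hγ, hη, hgI, heI]
  choose! σ2 hσ using fun φ (hφ : BddMeas φ) =>
    exists_tendsto_mul_variance (M0 := M0) (M := M) (n := n) hG' hc' hφ
  refine ⟨σ2, fun φ hφ hb => ?_, fun φ hφ hb => ⟨fun N hN _ => ?_, fun P _ hP => ⟨?_, ?_⟩,
    hσ φ ⟨hφ, hb⟩, ?_⟩⟩
  · exact ge_of_tendsto' (hσ φ ⟨hφ, hb⟩) fun N => mul_nonneg N.cast_nonneg (variance_nonneg _ _)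
  · exact integral_gammaN hG' (npart_pos hc' hN) n ⟨hφ, hb⟩
  · exact ae_tendsto_gammaN hP hG' hc' ⟨hφ, hb⟩
  · exact ae_tendsto_etaN hP hG' hc' le_rfl ⟨hφ, hb⟩
  · exact tendsto_mul_integral_etaN_sub_sq hG' hc' ⟨hφ, hb⟩
      (hσ _ (BddMeas.sub ⟨hφ, hb⟩ (.const _)))
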